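/- arXiv:1109.0345 — 2 statements merged into one kernel-verified Lean document; each statement's English description precedes it below -/
import Mathlib

section
/- Let two circular arcs both start at a common point p inside a region Q and end at two points on the boundary arc of Q, each lying entirely within Q. If the cyclic order of their tangent directions at p agrees with the cyclic order of their endpoints along the boundary arc, then the two arcs do not cross in the interior of Q. -/
open Set Metric

noncomputable section

/-- A `Piece` is a parameterized circular arc or line segment in the plane `ℂ`. -/
inductive Piece : Type
  | arc (c : ℂ) (r θ₀ θ₁ : ℝ) : Piece
  | seg (p q : ℂ) : Piece

namespace Piece

/-- The parameterization of a piece over `[0,1]`. -/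
def toFun : Piece → ℝ → ℂ
  | arc c r θ₀ θ₁, t => c + (r : ℂ) * Complex.exp (Complex.I * ((θ₀ + t * (θ₁ - θ₀) : ℝ) : ℂ))
  | seg p q, t => p + (t : ℂ) * (q - p)

/-- The velocity (tangent) vector of a piece at parameter `t`. -/
def tangent : Piece → ℝ → ℂ
  | arc c r θ₀ θ₁, t =>
      (r : ℂ) * ((θ₁ - θ₀ : ℝ) : ℂ) * Complex.I *
        Complex.exp (Complex.I * ((θ₀ + t * (θ₁ - θ₀) : ℝ) : ℂ))
  | seg p q, _ => q - p

/-- Starting point. -/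
def source (P : Piece) : ℂ := P.toFun 0

/-- Ending point. -/
def target (P : Piece) : ℂ := P.toFun 1

/-- The trace of the piece in the plane. -/
def image (P : Piece) : Set ℂ := P.toFun '' Set.Icc 0 1

/-- Nondegeneracy: the parameterization has nonvanishing velocity. -/
def Nondeg : Piece → Prop
  | arc _ r θ₀ θ₁ => r ≠ 0 ∧ θ₀ ≠ θ₁
  | seg p q => p ≠ q

end Piece

/-- The unsigned angle in `[0, π]` between two vectors of the plane `ℂ`. -/
def vecAngle (u v : ℂ) : ℝ := Real.arccos (((starRingEnd ℂ) u * v).re / (‖u‖ * ‖v‖))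

/-- The angle in `[0, π/2]` between the two *lines* spanned by `u` and `v`. -/
def lineAngle (u v : ℂ) : ℝ := Real.arccos (|((starRingEnd ℂ) u * v).re| / (‖u‖ * ‖v‖))

/-- The direction of a vector, as an angle modulo `2π`. -/
def dirAngle (z : ℂ) : Real.Angle := (Complex.arg z : Real.Angle)

/-- One of the four "quadrants" into which the closed disk bounded by the circle `C`
(center `o`, radius `R`) is divided by two circles `A` (center `A`, radius `rA`) and `B`
(center `B`, radius `rB`) perpendicular to `C` and to each other; the booleans `sA`, `sB`
select the side of `A` resp. `B`. -/
def quadrant (o A B : ℂ) (R rA rB : ℝ) (sA sB : Bool) : Set ℂ :=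
  Metric.closedBall o R ∩
    (if sA then Metric.closedBall A rA else (Metric.ball A rA)ᶜ) ∩
    (if sB then Metric.closedBall B rB else (Metric.ball B rB)ᶜ)

/-- Sign attached to a side. -/
def sg (s : Bool) : ℝ := if s then 1 else -1

/-- Inversion centered at `p`. -/
def invN (p z : ℂ) : ℂ := (((Complex.normSq (z - p))⁻¹ : ℝ) : ℂ) * (z - p)

/-- Real dot product. -/
def dotp (u v : ℂ) : ℝ := u.re * v.re + u.im * v.im

/-- Real cross product. -/
def crs (u v : ℂ) : ℝ := u.re * v.im - u.im * v.re

lemma sg_ne (s : Bool) : sg s = 1 ∨ sg s = -1 := by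
  cases s <;> simp [sg]

lemma dist_sq_eq (z w : ℂ) : dist z w ^ 2 = (z.re - w.re) ^ 2 + (z.im - w.im) ^ 2 := by
  rw [Complex.dist_eq, Complex.sq_norm, Complex.normSq_apply]
  simp; ring

lemma side_of_mem (s : Bool) (z A : ℂ) (r : ℝ) (hr : 0 < r)
    (h : z ∈ (if s then Metric.closedBall A r else (Metric.ball A r)ᶜ)) :
    sg s * (dist z A ^ 2 - r ^ 2) ≤ 0 := by
  have h0 : 0 ≤ dist z A := dist_nonneg
  cases s
  · simp at h
    simp [sg]; nlinarith
  · simp at h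
    simp [sg]; nlinarith

lemma deriv_nonpos_of_le (f : ℝ → ℝ) (f' : ℝ) (hf : HasDerivAt f f' 0) (h0 : f 0 = 0)
    (hle : ∀ t ∈ Set.Icc (0 : ℝ) 1, f t ≤ 0) : f' ≤ 0 := by
  have h := (hasDerivAt_iff_tendsto_slope_zero.1 hf)
  have h2 := h.mono_left (nhdsWithin_mono (0 : ℝ) (show Set.Ioi (0 : ℝ) ⊆ {0}ᶜ by
    intro x hx; simp at hx ⊢; exact hx.ne'))
  refine le_of_tendsto h2 ?_
  filter_upwards [Ioc_mem_nhdsGT (show (0 : ℝ) < 1 by norm_num)] with t ht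
  have := hle t ⟨ht.1.le, ht.2⟩
  simp only [zero_add, h0, sub_zero, smul_eq_mul]
  have h3 : 0 < t⁻¹ := inv_pos.2 ht.1
  nlinarith

lemma piece_hasDeriv (P : Piece) : HasDerivAt P.toFun (P.tangent 0) 0 := by
  cases P with
  | arc c r θ₀ θ₁ =>
    have h1 : HasDerivAt (fun t : ℝ => Complex.I * ((θ₀ + t * (θ₁ - θ₀) : ℝ) : ℂ))
        (Complex.I * ((θ₁ - θ₀ : ℝ) : ℂ)) 0 := by
      have : HasDerivAt (fun t : ℝ => θ₀ + t * (θ₁ - θ₀)) (θ₁ - θ₀) 0 := by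
        simpa using ((hasDerivAt_id (0 : ℝ)).mul_const (θ₁ - θ₀)).const_add θ₀
      exact (this.ofReal_comp).const_mul _
    have h2 := ((h1.cexp).const_mul (r : ℂ)).const_add c
    have e : (Piece.arc c r θ₀ θ₁).toFun = fun t : ℝ =>
      c + (r : ℂ) * Complex.exp (Complex.I * ((θ₀ + t * (θ₁ - θ₀) : ℝ) : ℂ)) := by
      funext t; rfl
    rw [e]
    refine h2.congr_deriv ?_
    simp only [Piece.tangent]
    ring
  | seg p q =>
    have h1 : HasDerivAt (fun t : ℝ => p + (t : ℂ) * (q - p)) (q - p) 0 := by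
      simpa using (((hasDerivAt_id (0 : ℝ)).ofReal_comp).mul_const (q - p)).const_add p
    exact h1

lemma side_hasDeriv (P : Piece) (p A : ℂ) (r σ : ℝ) (hs : P.source = p) :
    HasDerivAt (fun t => σ * (dist (P.toFun t) A ^ 2 - r ^ 2))
      (-(2 * (σ * dotp (A - p) (P.tangent 0)))) 0 := by
  have h := piece_hasDeriv P
  have hre : HasDerivAt (fun t => (P.toFun t).re) (P.tangent 0).re 0 :=
    Complex.reCLM.hasFDerivAt.comp_hasDerivAt 0 h
  have him : HasDerivAt (fun t => (P.toFun t).im) (P.tangent 0).im 0 :=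
    Complex.imCLM.hasFDerivAt.comp_hasDerivAt 0 h
  have h2 := ((((hre.sub_const A.re).pow 2).add ((him.sub_const A.im).pow 2)).sub_const
    (r ^ 2)).const_mul σ
  have e : P.toFun 0 = p := hs
  simp only [dist_sq_eq]
  refine HasDerivAt.congr_deriv h2 ?_
  rw [e]
  simp [dotp]
  ring

lemma cone_of_piece (P : Piece) (p A : ℂ) (r σ : ℝ) (hs : P.source = p)
    (hp : dist p A = r)
    (hin : ∀ z ∈ P.image, σ * (dist z A ^ 2 - r ^ 2) ≤ 0) :
    0 ≤ σ * dotp (A - p) (P.tangent 0) := by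
  have h := deriv_nonpos_of_le _ _ (side_hasDeriv P p A r σ hs)
    (by have e : P.toFun 0 = p := hs
        rw [e, hp]; ring) (fun t ht => hin _ ⟨t, ht, rfl⟩)
  linarith

lemma cone_zero_of_long (c : ℂ) (ρ θ₀ θ₁ : ℝ) (p A : ℂ) (r σ : ℝ)
    (hs : (Piece.arc c ρ θ₀ θ₁).source = p)
    (hlong : 2 * Real.pi ≤ |θ₁ - θ₀|)
    (hp : dist p A = r)
    (hin : ∀ z ∈ (Piece.arc c ρ θ₀ θ₁).image, σ * (dist z A ^ 2 - r ^ 2) ≤ 0) :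
    σ * dotp (A - p) ((Piece.arc c ρ θ₀ θ₁).tangent 0) = 0 := by
  set P := Piece.arc c ρ θ₀ θ₁ with hP
  have hpi := Real.pi_pos
  have hd : θ₁ - θ₀ ≠ 0 := by
    intro h; rw [h] at hlong; simp at hlong; linarith
  have habs : 0 < |θ₁ - θ₀| := abs_pos.2 hd
  set t0 := 2 * Real.pi / |θ₁ - θ₀| with ht0
  have t0pos : 0 < t0 := by positivity
  have t0le : t0 ≤ 1 := (div_le_one habs).2 hlong
  have hper : ∀ t, P.toFun (t + t0) = P.toFun t := by
    intro t
    simp only [hP, Piece.toFun]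
    congr 2
    rcases lt_or_gt_of_ne hd with h | h
    · have e : θ₀ + (t + t0) * (θ₁ - θ₀) = θ₀ + t * (θ₁ - θ₀) - 2 * Real.pi := by
        rw [ht0, abs_of_neg h]; field_simp; ring
      rw [e]; push_cast
      rw [show Complex.I * ((θ₀ : ℂ) + t * (θ₁ - θ₀) - 2 * Real.pi)
        = Complex.I * (θ₀ + t * (θ₁ - θ₀)) - 2 * Real.pi * Complex.I by ring]
      exact Complex.exp_periodic.sub_eq _
    · have e : θ₀ + (t + t0) * (θ₁ - θ₀) = θ₀ + t * (θ₁ - θ₀) + 2 * Real.pi := by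
        rw [ht0, abs_of_pos h]; field_simp; ring
      rw [e]; push_cast
      rw [show Complex.I * ((θ₀ : ℂ) + t * (θ₁ - θ₀) + 2 * Real.pi)
        = Complex.I * (θ₀ + t * (θ₁ - θ₀)) + 2 * Real.pi * Complex.I by ring]
      exact Complex.exp_periodic _
  have hmax : IsLocalMax (fun t => σ * (dist (P.toFun t) A ^ 2 - r ^ 2)) 0 := by
    filter_upwards [Ioo_mem_nhds (show -t0 < 0 by linarith) (show (0 : ℝ) < 1 by norm_num)]
      with t ht
    have e : P.toFun 0 = p := hs
    simp only [e, hp, sub_self, mul_zero]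
    by_cases h : 0 ≤ t
    · exact hin _ ⟨t, ⟨h, ht.2.le⟩, rfl⟩
    · rw [← hper t]
      exact hin _ ⟨t + t0, ⟨by linarith [ht.1], by linarith⟩, rfl⟩
  have := hmax.hasDerivAt_eq_zero (side_hasDeriv P p A r σ hs)
  linarith

lemma sin_sign (d s : ℝ) (hd : d ≠ 0) (hd2 : |d| < 2 * Real.pi) (hs : 0 < s) (hs1 : s ≤ 1) :
    0 < d * Real.sin (s * d / 2) := by
  have hpi := Real.pi_pos
  rw [abs_lt] at hd2
  rcases lt_or_gt_of_ne hd with h | h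
  · apply mul_pos_of_neg_of_neg h
    apply Real.sin_neg_of_neg_of_neg_pi_lt <;> nlinarith
  · apply mul_pos h
    apply Real.sin_pos_of_pos_of_lt_pi <;> nlinarith

lemma arc_sub_source (c : ℂ) (r θ₀ θ₁ t : ℝ) :
    (Piece.arc c r θ₀ θ₁).toFun t - (Piece.arc c r θ₀ θ₁).source =
      ((r * (2 * Real.sin (t * (θ₁ - θ₀) / 2)) : ℝ) : ℂ) * Complex.exp (Complex.I * (θ₀ : ℂ))
       * (Complex.I * Real.cos (t * (θ₁ - θ₀) / 2) - Real.sin (t * (θ₁ - θ₀) / 2)) := by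
  simp only [Piece.source, Piece.toFun]
  have e : Complex.exp (Complex.I * ((θ₀ + t * (θ₁ - θ₀) : ℝ) : ℂ)) =
      Complex.exp (Complex.I * (θ₀ : ℂ)) *
       (Real.cos (t * (θ₁ - θ₀)) + Real.sin (t * (θ₁ - θ₀)) * Complex.I) := by
    rw [Complex.ofReal_cos, Complex.ofReal_sin, ← Complex.exp_mul_I, ← Complex.exp_add]
    congr 1; push_cast; ring
  rw [e]
  set x := t * (θ₁ - θ₀) / 2 with hx
  rw [show t * (θ₁ - θ₀) = 2 * x by rw [hx]; ring, Real.cos_two_mul, Real.sin_two_mul]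
  have hsc : ((Real.sin x : ℝ) : ℂ) ^ 2 + ((Real.cos x : ℝ) : ℂ) ^ 2 = 1 := by
    exact_mod_cast Real.sin_sq_add_cos_sq x
  push_cast at hsc ⊢
  simp only [zero_mul, add_zero]
  linear_combination (2 * (r : ℂ) * Complex.exp (Complex.I * (θ₀ : ℂ))) * hsc

lemma invN_form (p z E : ℂ) (r s k : ℝ) (hE : Complex.normSq E = 1) (hr : r ≠ 0) (hs : s ≠ 0)
    (hk : s ^ 2 + k ^ 2 = 1)
    (h : z - p = ((r * (2 * s) : ℝ) : ℂ) * E * (Complex.I * k - s)) :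
    invN p z = ((1 / (2 * r) : ℝ) : ℂ) * E * (Complex.I * (k / s : ℝ) - 1) := by
  have hn : Complex.normSq (z - p) = (r * (2 * s)) ^ 2 := by
    rw [h, Complex.normSq_mul, Complex.normSq_mul, hE, Complex.normSq_ofReal]
    have : Complex.normSq (Complex.I * k - s) = 1 := by
      rw [Complex.normSq_apply]; simp; nlinarith
    rw [this]; ring
  rw [invN, hn, h]
  have hr' : (r : ℂ) ≠ 0 := by exact_mod_cast hr
  have hs' : (s : ℂ) ≠ 0 := by exact_mod_cast hs
  push_cast
  field_simp

lemma ray_of_piece (P : Piece) (p : ℂ) (hs : P.source = p) (hnd : P.Nondeg)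
    (hshort : ∀ c r θ₀ θ₁, P = Piece.arc c r θ₀ θ₁ → |θ₁ - θ₀| < 2 * Real.pi)
    (z : ℂ) (hz : z ∈ P.image) (hzp : z ≠ p) :
    ∃ l : ℝ, 0 ≤ l ∧ invN p z = invN p P.target + (l : ℂ) * P.tangent 0 := by
  obtain ⟨t, ⟨ht0, ht1⟩, rfl⟩ := hz
  have htpos : 0 < t := by
    rcases ht0.eq_or_lt with h | h
    · exfalso; apply hzp; rw [← h]; exact hs
    · exact h
  cases P with
  | arc c r θ₀ θ₁ =>
    obtain ⟨hr, hθ⟩ := hnd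
    have hlt := hshort c r θ₀ θ₁ rfl
    set d := θ₁ - θ₀ with hd
    have hd0 : d ≠ 0 := by rw [hd]; exact sub_ne_zero.2 hθ.symm
    have hst := sin_sign d t hd0 hlt htpos ht1
    have hs1 := sin_sign d 1 hd0 hlt one_pos le_rfl
    have hsd : 0 ≤ d * Real.sin ((1 - t) * d / 2) := by
      rcases ht1.eq_or_lt with h | h
      · rw [h]; simp
      · exact (sin_sign d (1 - t) hd0 hlt (by linarith) (by linarith)).le
    have hE : Complex.normSq (Complex.exp (Complex.I * (θ₀ : ℂ))) = 1 := by
      rw [Complex.normSq_eq_norm_sq, mul_comm, Complex.norm_exp_ofReal_mul_I]; norm_num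
    have e1 := arc_sub_source c r θ₀ θ₁ t
    have e2 := arc_sub_source c r θ₀ θ₁ 1
    rw [hs, ← hd] at e1 e2
    have hst0 : Real.sin (t * d / 2) ≠ 0 := fun h => by rw [h] at hst; simp at hst
    have hs10 : Real.sin (1 * d / 2) ≠ 0 := fun h => by rw [h] at hs1; simp at hs1
    have f1 := invN_form _ _ _ r _ _ hE hr hst0 (Real.sin_sq_add_cos_sq _) e1
    have f2 := invN_form _ _ _ r _ _ hE hr hs10 (Real.sin_sq_add_cos_sq _) e2
    have hdiff : Real.sin ((1 - t) * d / 2) = Real.sin (1 * d / 2) * Real.cos (t * d / 2)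
        - Real.cos (1 * d / 2) * Real.sin (t * d / 2) := by
      rw [← Real.sin_sub]; congr 1; ring
    refine ⟨d * Real.sin ((1 - t) * d / 2) /
      (2 * r ^ 2 * (d * Real.sin (t * d / 2)) * (d * Real.sin (1 * d / 2))), by positivity, ?_⟩
    rw [f1, Piece.target, f2, hdiff]
    simp only [Piece.tangent, zero_mul, add_zero, ← hd]
    generalize Real.sin (t * d / 2) = s at *
    generalize Real.sin (1 * d / 2) = s' at *
    generalize Real.cos (t * d / 2) = k
    generalize Real.cos (1 * d / 2) = k'
    have hr' : (r : ℂ) ≠ 0 := by exact_mod_cast hr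
    have hs' : (s : ℂ) ≠ 0 := by exact_mod_cast hst0
    have hs'' : (s' : ℂ) ≠ 0 := by exact_mod_cast hs10
    have hd' : (d : ℂ) ≠ 0 := by exact_mod_cast hd0
    push_cast
    field_simp
    ring
  | seg a b =>
    have hab : a ≠ b := hnd
    have ha : a = p := by rw [← hs]; simp [Piece.source, Piece.toFun]
    subst ha
    have e1 : (Piece.seg a b).toFun t - a = (t : ℂ) * (b - a) := by simp [Piece.toFun]
    have e2 : (Piece.seg a b).target - a = b - a := by simp [Piece.toFun, Piece.target]
    have hn : 0 < Complex.normSq (b - a) := Complex.normSq_pos.2 (sub_ne_zero.2 hab.symm)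
    refine ⟨(1 / t - 1) * (Complex.normSq (b - a))⁻¹, ?_, ?_⟩
    · have : 1 ≤ 1 / t := by rw [le_div_iff₀ htpos]; linarith
      have : 0 ≤ 1 / t - 1 := by linarith
      positivity
    · rw [invN, invN, e1, e2, Complex.normSq_mul, Complex.normSq_ofReal]
      simp only [Piece.tangent]
      have hr' : (t : ℂ) ≠ 0 := by exact_mod_cast htpos.ne'
      have hn' : ((Complex.normSq (b - a) : ℝ) : ℂ) ≠ 0 := by exact_mod_cast hn.ne'
      push_cast
      field_simp
      ring

lemma tangent_ne (P : Piece) (hnd : P.Nondeg) : P.tangent 0 ≠ 0 := by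
  cases P with
  | arc c r θ₀ θ₁ =>
    obtain ⟨hr, hθ⟩ := hnd
    have : (r : ℂ) ≠ 0 := by exact_mod_cast hr
    have h2 : ((θ₁ - θ₀ : ℝ) : ℂ) ≠ 0 := by exact_mod_cast sub_ne_zero.2 hθ.symm
    exact mul_ne_zero (mul_ne_zero (mul_ne_zero this h2) Complex.I_ne_zero) (Complex.exp_ne_zero _)
  | seg p q => exact sub_ne_zero.2 (Ne.symm hnd)

/-- Parseval identity for an orthogonal frame. -/
lemma frame (α β S V : ℂ) (hβ : β ≠ 0) (hαβ : dotp α β = 0) :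
    ∃ k : ℝ, dotp α α = k ^ 2 * dotp β β ∧
      dotp S V * (dotp α α * dotp β β) =
      dotp α S * dotp α V * dotp β β + dotp β S * dotp β V * dotp α α := by
  have hb : 0 < β.re * β.re + β.im * β.im := by
    have := Complex.normSq_pos.2 hβ
    rwa [Complex.normSq_apply] at this
  obtain ⟨k, hk1, hk2⟩ : ∃ k : ℝ, α.re = - k * β.im ∧ α.im = k * β.re := by
    refine ⟨(α.im * β.re - α.re * β.im) / (β.re * β.re + β.im * β.im), ?_, ?_⟩
    · rw [neg_mul, div_mul_eq_mul_div, ← neg_div, eq_div_iff hb.ne']; simp only [dotp] at hαβ; linear_combination β.re * hαβ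
    · rw [div_mul_eq_mul_div, eq_div_iff hb.ne']; simp only [dotp] at hαβ; linear_combination β.im * hαβ
  refine ⟨k, ?_, ?_⟩
  · simp only [dotp, hk1, hk2]; ring
  · simp only [dotp, hk1, hk2]; ring

lemma dotp_self_pos (α : ℂ) (h : α ≠ 0) : 0 < dotp α α := by
  have := Complex.normSq_pos.2 h
  rwa [Complex.normSq_apply] at this

lemma dotp_nonneg_of_cone (α β S V : ℂ) (hα : α ≠ 0) (hβ : β ≠ 0) (hαβ : dotp α β = 0)
    (h1 : 0 ≤ dotp α S) (h2 : 0 ≤ dotp β S) (h3 : 0 ≤ dotp α V) (h4 : 0 ≤ dotp β V) :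
    0 ≤ dotp S V := by
  obtain ⟨k, -, h⟩ := frame α β S V hβ hαβ
  have a := dotp_self_pos α hα
  have b := dotp_self_pos β hβ
  have : 0 ≤ dotp S V * (dotp α α * dotp β β) := by rw [h]; positivity
  exact nonneg_of_mul_nonneg_left this (by positivity)

lemma eq_zero_of_dotp (α β V : ℂ) (hα : α ≠ 0) (hβ : β ≠ 0) (hαβ : dotp α β = 0)
    (h3 : dotp α V = 0) (h4 : dotp β V = 0) : V = 0 := by
  obtain ⟨k, -, h⟩ := frame α β V V hβ hαβ
  have a := dotp_self_pos α hα
  have b := dotp_self_pos β hβ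
  by_contra hV
  have c := dotp_self_pos V hV
  rw [h3, h4] at h
  have : 0 < dotp V V * (dotp α α * dotp β β) := by positivity
  linarith

lemma crs_zero_of_perp (α U₁ U₂ : ℂ) (hα : α ≠ 0) (h1 : dotp α U₁ = 0) (h2 : dotp α U₂ = 0) :
    crs U₁ U₂ = 0 := by
  have a := dotp_self_pos α hα
  have : crs U₁ U₂ * dotp α α = 0 := by
    simp only [dotp, crs] at *
    linear_combination (α.re * U₂.im - α.im * U₂.re) * h1 + (α.im * U₁.re - α.re * U₁.im) * h2
  exact (mul_eq_zero.1 this).resolve_right a.ne'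

lemma no_meet (α β U₁ U₂ V₁ V₂ : ℂ) (hα : α ≠ 0) (hβ : β ≠ 0) (hαβ : dotp α β = 0)
    (a1 : 0 ≤ dotp α U₁) (b1 : 0 ≤ dotp β U₁) (a2 : 0 ≤ dotp α U₂) (b2 : 0 ≤ dotp β U₂)
    (c2 : 0 ≤ dotp α V₂) (d2 : 0 ≤ dotp β V₂) (hV : V₂ ≠ 0)
    (hn : dotp U₁ U₁ = dotp U₂ U₂) (hU : 0 < crs U₁ U₂) (hVV : 0 ≤ crs V₁ V₂)
    (l₁ l₂ : ℝ) (hl : 0 ≤ l₁) (h : U₁ + l₁ * V₁ = U₂ + l₂ * V₂) : False := by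
  have e1 : dotp α (U₁ + U₂) = dotp α U₁ + dotp α U₂ := by simp [dotp]; ring
  have e2 : dotp β (U₁ + U₂) = dotp β U₁ + dotp β U₂ := by simp [dotp]; ring
  have p1 : 0 < dotp α (U₁ + U₂) := by
    rw [e1]
    by_contra hc
    have := crs_zero_of_perp α U₁ U₂ hα (by linarith) (by linarith)
    linarith
  have p2 : 0 < dotp β (U₁ + U₂) := by
    rw [e2]
    by_contra hc
    have := crs_zero_of_perp β U₁ U₂ hβ (by linarith) (by linarith)
    linarith
  have pa := dotp_self_pos α hα
  have pb := dotp_self_pos β hβ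
  have hSV : 0 < dotp (U₁ + U₂) V₂ := by
    obtain ⟨k, -, hk⟩ := frame α β (U₁ + U₂) V₂ hβ hαβ
    have : 0 < dotp (U₁ + U₂) V₂ * (dotp α α * dotp β β) := by
      rw [hk]
      rcases c2.eq_or_lt with hc | hc
      · rcases d2.eq_or_lt with hd | hd
        · exact absurd (eq_zero_of_dotp α β V₂ hα hβ hαβ hc.symm hd.symm) hV
        · rw [← hc]; positivity
      · positivity
    exact pos_of_mul_pos_left this (by positivity)
  have hre : U₁.re + l₁ * V₁.re = U₂.re + l₂ * V₂.re := by
    have := congrArg Complex.re h; simpa using this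
  have him : U₁.im + l₁ * V₁.im = U₂.im + l₂ * V₂.im := by
    have := congrArg Complex.im h; simpa using this
  have key : l₁ * crs V₁ V₂ * dotp (U₁ + U₂) (U₁ + U₂) =
      -2 * crs U₁ U₂ * dotp (U₁ + U₂) V₂ := by
    have k1 : l₁ * crs V₁ V₂ = (U₂.re - U₁.re) * V₂.im - (U₂.im - U₁.im) * V₂.re := by
      simp only [crs]; linear_combination V₂.im * hre - V₂.re * him
    rw [k1]
    simp only [crs, dotp, Complex.add_re, Complex.add_im] at hn ⊢
    linear_combination ((U₁.im + U₂.im) * V₂.re - (U₁.re + U₂.re) * V₂.im) * hn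
  have n1 : 0 ≤ dotp (U₁ + U₂) (U₁ + U₂) := by
    simp only [dotp]; nlinarith [sq_nonneg (U₁ + U₂).re, sq_nonneg (U₁ + U₂).im]
  have : 0 ≤ l₁ * crs V₁ V₂ * dotp (U₁ + U₂) (U₁ + U₂) := by positivity
  have : 0 < crs U₁ U₂ * dotp (U₁ + U₂) V₂ := by positivity
  linarith

/-- The half-angle quantity whose square is the quotient of inverted boundary points. -/
def eta (R : ℝ) (h : ℂ) (φ₁ φ₂ : ℝ) : ℂ :=
  (starRingEnd ℂ) ((R : ℂ) * Complex.exp (Complex.I * (φ₁ : ℂ)) - h) *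
    ((R : ℂ) * Complex.exp (Complex.I * (φ₂ : ℂ)) - h) *
    Complex.exp (Complex.I * ((-((φ₂ - φ₁) / 2) : ℝ) : ℂ))

lemma conj_expI (x : ℝ) : (starRingEnd ℂ) (Complex.exp (Complex.I * (x : ℂ))) =
    Complex.exp (Complex.I * ((-x : ℝ) : ℂ)) := by
  rw [← Complex.exp_conj]; simp

lemma expI_add (x y : ℝ) : Complex.exp (Complex.I * ((x + y : ℝ) : ℂ)) =
    Complex.exp (Complex.I * (x : ℂ)) * Complex.exp (Complex.I * (y : ℂ)) := by
  rw [← Complex.exp_add]; congr 1; push_cast; ring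

lemma expI_mul_neg (x : ℝ) : Complex.exp (Complex.I * (x : ℂ)) *
    Complex.exp (Complex.I * ((-x : ℝ) : ℂ)) = 1 := by
  rw [← expI_add]; simp

lemma expI_im (x : ℝ) : (Complex.exp (Complex.I * (x : ℂ))).im = Real.sin x := by
  rw [mul_comm, Complex.exp_ofReal_mul_I_im]

lemma eta_im (R : ℝ) (h : ℂ) (φ₁ φ₂ : ℝ) :
    (eta R h φ₁ φ₂).im = (R ^ 2 - Complex.normSq h) * Real.sin ((φ₂ - φ₁) / 2) := by
  obtain ⟨m, hm⟩ : ∃ m, m = (φ₁ + φ₂) / 2 := ⟨_, rfl⟩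
  obtain ⟨x, hx⟩ : ∃ x, x = (φ₂ - φ₁) / 2 := ⟨_, rfl⟩
  have e1 : φ₁ = m + -x := by rw [hm, hx]; ring
  have e2 : φ₂ = m + x := by rw [hm, hx]; ring
  have key : eta R h φ₁ φ₂ = ((R ^ 2 : ℝ) : ℂ) * Complex.exp (Complex.I * (x : ℂ))
      + ((Complex.normSq h : ℝ) : ℂ) * Complex.exp (Complex.I * ((-x : ℝ) : ℂ))
      - (R : ℂ) * ((h * Complex.exp (Complex.I * ((-m : ℝ) : ℂ))) +
        (starRingEnd ℂ) (h * Complex.exp (Complex.I * ((-m : ℝ) : ℂ)))) := by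
    have hh := Complex.mul_conj h
    simp only [eta, ← hx, map_sub, map_mul, Complex.conj_ofReal, conj_expI]
    rw [show -φ₁ = -m + x by rw [e1]; ring, e2, expI_add, expI_add, neg_neg]
    have k1 := expI_mul_neg x
    have k2 := expI_mul_neg m
    generalize Complex.exp (Complex.I * (x : ℂ)) = X at *
    generalize Complex.exp (Complex.I * ((-x : ℝ) : ℂ)) = X' at *
    generalize Complex.exp (Complex.I * (m : ℂ)) = M at *
    generalize Complex.exp (Complex.I * ((-m : ℝ) : ℂ)) = M' at *
    push_cast
    linear_combination (R ^ 2 * M * M' * X - R * h * M' - R * (starRingEnd ℂ) h * M) * k1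
      + R ^ 2 * X * k2 + X' * hh
  rw [key, ← hx, Complex.add_conj]
  simp only [Complex.sub_im, Complex.add_im, Complex.im_ofReal_mul, expI_im, Real.sin_neg,
    Complex.ofReal_im]
  ring

/-- Inverted boundary point, recentered. -/
def bU (R : ℝ) (o p : ℂ) (φ : ℝ) : ℂ :=
  invN p (o + (R : ℂ) * Complex.exp (Complex.I * (φ : ℂ))) -
    (((R ^ 2 - Complex.normSq (p - o))⁻¹ : ℝ) : ℂ) * (p - o)

lemma bU_form (R : ℝ) (o p : ℂ) (φ : ℝ) (hR : 0 < R) (hD : 0 < R ^ 2 - Complex.normSq (p - o)) :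
    0 < Complex.normSq ((R : ℂ) * Complex.exp (Complex.I * (φ : ℂ)) - (p - o)) ∧
    bU R o p φ = ((R / ((R ^ 2 - Complex.normSq (p - o)) *
      Complex.normSq ((R : ℂ) * Complex.exp (Complex.I * (φ : ℂ)) - (p - o))) : ℝ) : ℂ) *
      (((R : ℂ) * Complex.exp (Complex.I * (φ : ℂ)) - (p - o)) ^ 2 *
        Complex.exp (Complex.I * ((-φ : ℝ) : ℂ))) := by
  have hpos : 0 < Complex.normSq ((R : ℂ) * Complex.exp (Complex.I * (φ : ℂ)) - (p - o)) := by
    rw [Complex.normSq_pos]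
    intro h0
    have h1 := sub_eq_zero.1 h0
    rw [← h1, Complex.normSq_mul, Complex.normSq_ofReal, Complex.normSq_eq_norm_sq, mul_comm Complex.I,
      Complex.norm_exp_ofReal_mul_I] at hD
    nlinarith
  refine ⟨hpos, ?_⟩
  have ez : o + (R : ℂ) * Complex.exp (Complex.I * (φ : ℂ)) - p =
      (R : ℂ) * Complex.exp (Complex.I * (φ : ℂ)) - (p - o) := by ring
  rw [bU, invN, ez]
  set h := p - o
  have hh := Complex.mul_conj h
  have hd := Complex.mul_conj ((R : ℂ) * Complex.exp (Complex.I * (φ : ℂ)) - h)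
  set n := Complex.normSq ((R : ℂ) * Complex.exp (Complex.I * (φ : ℂ)) - h)
  simp only [map_sub, map_mul, Complex.conj_ofReal, conj_expI] at hd
  have k := expI_mul_neg φ
  have hn' : (n : ℂ) ≠ 0 := by exact_mod_cast hpos.ne'
  have hD' : (R : ℂ) ^ 2 - (Complex.normSq h : ℂ) ≠ 0 := by exact_mod_cast hD.ne'
  generalize Complex.exp (Complex.I * (φ : ℂ)) = X at *
  generalize Complex.exp (Complex.I * ((-φ : ℝ) : ℂ)) = X' at *
  push_cast
  rw [← hh] at hD' ⊢
  field_simp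
  rw [← hd]
  linear_combination (-(R : ℂ) ^ 2 * (R * X - h)) * k

lemma bU_norm (R : ℝ) (o p : ℂ) (φ : ℝ) (hR : 0 < R) (hD : 0 < R ^ 2 - Complex.normSq (p - o)) :
    dotp (bU R o p φ) (bU R o p φ) = (R / (R ^ 2 - Complex.normSq (p - o))) ^ 2 := by
  obtain ⟨hn, h⟩ := bU_form R o p φ hR hD
  have : dotp (bU R o p φ) (bU R o p φ) = Complex.normSq (bU R o p φ) := by
    rw [Complex.normSq_apply]; rfl
  rw [this, h, Complex.normSq_mul, Complex.normSq_mul, Complex.normSq_ofReal, map_pow]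
  rw [Complex.normSq_eq_norm_sq (Complex.exp _), mul_comm Complex.I ((-φ : ℝ) : ℂ),
    Complex.norm_exp_ofReal_mul_I]
  field_simp

lemma bU_pair (R : ℝ) (o p : ℂ) (φ₁ φ₂ : ℝ) (hR : 0 < R)
    (hD : 0 < R ^ 2 - Complex.normSq (p - o)) :
    ∃ k : ℝ, 0 < k ∧ (starRingEnd ℂ) (bU R o p φ₁) * bU R o p φ₂ =
      (k : ℂ) * eta R (p - o) φ₁ φ₂ ^ 2 := by
  obtain ⟨hn1, h1⟩ := bU_form R o p φ₁ hR hD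
  obtain ⟨hn2, h2⟩ := bU_form R o p φ₂ hR hD
  refine ⟨_, mul_pos (div_pos hR (mul_pos hD hn1)) (div_pos hR (mul_pos hD hn2)), ?_⟩
  rw [h1, h2, eta]
  have e : Complex.exp (Complex.I * ((-((φ₂ - φ₁) / 2) : ℝ) : ℂ)) ^ 2 =
      Complex.exp (Complex.I * (φ₁ : ℂ)) * Complex.exp (Complex.I * ((-φ₂ : ℝ) : ℂ)) := by
    rw [pow_two, ← expI_add, ← expI_add]; congr 3; ring
  rw [mul_pow, e]
  simp only [map_mul, map_pow, Complex.conj_ofReal, conj_expI (-φ₁), neg_neg, Complex.ofReal_mul]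
  ring

lemma crs_bU_pos (R : ℝ) (o p : ℂ) (φ₁ φ₂ : ℝ) (hR : 0 < R)
    (hD : 0 < R ^ 2 - Complex.normSq (p - o)) (h12 : φ₁ < φ₂) (h2 : φ₂ < φ₁ + 2 * Real.pi)
    (hdot : ∀ φ ∈ Set.Icc φ₁ φ₂, 0 ≤ dotp (bU R o p φ₁) (bU R o p φ)) :
    0 < crs (bU R o p φ₁) (bU R o p φ₂) := by
  have him : ∀ φ ∈ Set.Ioc φ₁ φ₂, 0 < (eta R (p - o) φ₁ φ).im := by
    intro φ hφ
    rw [eta_im]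
    apply mul_pos hD
    apply Real.sin_pos_of_pos_of_lt_pi <;> linarith [hφ.1, hφ.2]
  have hre0 : 0 < (eta R (p - o) φ₁ φ₁).re := by
    obtain ⟨hn, -⟩ := bU_form R o p φ₁ hR hD
    simp only [eta, sub_self, zero_div, neg_zero, Complex.ofReal_zero, mul_zero, Complex.exp_zero,
      mul_one]
    rw [mul_comm, Complex.mul_conj, Complex.ofReal_re]
    exact hn
  have hne : ∀ φ ∈ Set.Icc φ₁ φ₂, (eta R (p - o) φ₁ φ).re ≠ 0 := by
    intro φ hφ h0
    rcases hφ.1.eq_or_lt with h | h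
    · rw [← h] at h0; linarith
    · have i := him φ ⟨h, hφ.2⟩
      have d := hdot φ hφ
      obtain ⟨k, hk, e⟩ := bU_pair R o p φ₁ φ hR hD
      have e' := congrArg Complex.re e
      rw [Complex.re_ofReal_mul, pow_two, Complex.mul_re, Complex.mul_re, h0] at e'
      simp only [Complex.conj_re, Complex.conj_im] at e'
      simp only [dotp] at d
      have : 0 < k * ((eta R (p - o) φ₁ φ).im * (eta R (p - o) φ₁ φ).im) := by positivity
      linarith
  have hcont : ContinuousOn (fun φ => (eta R (p - o) φ₁ φ).re) (Set.Icc φ₁ φ₂) := by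
    apply Continuous.continuousOn
    unfold eta
    fun_prop
  have hpos : 0 < (eta R (p - o) φ₁ φ₂).re := by
    by_contra hc
    obtain ⟨φ, hφ, h0⟩ := intermediate_value_Icc' h12.le hcont
      (show (0 : ℝ) ∈ Set.Icc _ _ from ⟨not_lt.1 hc, hre0.le⟩)
    exact hne φ hφ h0
  have i := him φ₂ ⟨h12, le_rfl⟩
  obtain ⟨k, hk, e⟩ := bU_pair R o p φ₁ φ₂ hR hD
  have e' := congrArg Complex.im e
  rw [Complex.im_ofReal_mul, pow_two, Complex.mul_im, Complex.mul_im] at e'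
  simp only [Complex.conj_re, Complex.conj_im] at e'
  have : 0 < k * ((eta R (p - o) φ₁ φ₂).re * (eta R (p - o) φ₁ φ₂).im
    + (eta R (p - o) φ₁ φ₂).im * (eta R (p - o) φ₁ φ₂).re) := by positivity
  simp only [crs]
  linarith

lemma cone_of_point (σ : ℝ) (o A p z : ℂ) (R r : ℝ) (hAC : dist A o ^ 2 = r ^ 2 + R ^ 2)
    (hpA : dist p A = r) (hD : 0 < R ^ 2 - Complex.normSq (p - o)) (hzp : z ≠ p)
    (hz : σ * (dist z A ^ 2 - r ^ 2) ≤ 0) :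
    0 ≤ dotp ((σ : ℂ) * (A - p)) (invN p z -
      (((R ^ 2 - Complex.normSq (p - o))⁻¹ : ℝ) : ℂ) * (p - o)) := by
  have hn : 0 < Complex.normSq (z - p) := Complex.normSq_pos.2 (sub_ne_zero.2 hzp)
  have hpA2 : dist p A ^ 2 = r ^ 2 := by rw [hpA]
  rw [dist_sq_eq] at hAC hz hpA2
  obtain ⟨n, hnn⟩ : ∃ n, n = Complex.normSq (z - p) := ⟨_, rfl⟩
  obtain ⟨D, hDD⟩ : ∃ D, D = R ^ 2 - Complex.normSq (p - o) := ⟨_, rfl⟩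
  have a1 : dotp (A - p) (z - p) * 2 - n = -((z.re - A.re) ^ 2 + (z.im - A.im) ^ 2 - r ^ 2) := by
    rw [hnn, Complex.normSq_apply]; simp only [dotp, Complex.sub_re, Complex.sub_im]
    linear_combination hpA2
  have a2 : dotp (A - p) (p - o) * 2 = D := by
    rw [hDD, Complex.normSq_apply]; simp only [dotp, Complex.sub_re, Complex.sub_im]
    linear_combination hAC - hpA2
  have a3 : dotp ((σ : ℂ) * (A - p)) (invN p z -
      (((R ^ 2 - Complex.normSq (p - o))⁻¹ : ℝ) : ℂ) * (p - o)) =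
      σ * (n⁻¹ * dotp (A - p) (z - p) - D⁻¹ * dotp (A - p) (p - o)) := by
    rw [invN, ← hnn, ← hDD]
    simp only [dotp, Complex.re_ofReal_mul, Complex.im_ofReal_mul, Complex.sub_re, Complex.sub_im]
    ring
  rw [← hnn] at hn
  rw [← hDD] at hD
  have a4 : σ * (n⁻¹ * dotp (A - p) (z - p) - D⁻¹ * dotp (A - p) (p - o)) =
      (1 / (2 * n)) * (σ * (dotp (A - p) (z - p) * 2 - n)) := by
    have hq : D⁻¹ * dotp (A - p) (p - o) = 1 / 2 := by
      rw [show dotp (A - p) (p - o) = D / 2 by linarith]; field_simp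
    rw [hq]
    field_simp
  rw [a3, a4, a1]
  have : 0 ≤ σ * -((z.re - A.re) ^ 2 + (z.im - A.im) ^ 2 - r ^ 2) := by linarith
  positivity

open Real in
/-- Let `Q` be a quadrant region of the disk bounded by `C` (cut out by
circles `A`, `B` perpendicular to `C` and to each other, meeting at `p` inside `C`), whose
boundary arc of `C` is `{o + R·exp(iφ) : φ ∈ [φA, φB]}`.  If two circular arcs start at `p`,
end at two distinct points `o + R·exp(iφ₁)`, `o + R·exp(iφ₂)` of the boundary arc, lie
entirely within `Q`, and the (cyclic) order of their tangent directions at `p` agrees with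
the order of their endpoints along the boundary arc, then the two arcs do not cross in the
interior of `Q` (they meet at most at `p`). -/
theorem consistent_arcs_do_not_cross
    (o A B p : ℂ) (R rA rB : ℝ) (hR : 0 < R) (hrA : 0 < rA) (hrB : 0 < rB)
    (hAC : dist A o ^ 2 = rA ^ 2 + R ^ 2)
    (hBC : dist B o ^ 2 = rB ^ 2 + R ^ 2)
    (hAB : dist A B ^ 2 = rA ^ 2 + rB ^ 2)
    (hpA : dist p A = rA) (hpB : dist p B = rB) (hpo : dist p o < R)
    (sA sB : Bool)
    (φA φB : ℝ) (hφ : φA < φB) (hφ2 : φB ≤ φA + 2 * π)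
    (harc : ∀ φ ∈ Set.Icc φA φB,
      o + (R : ℂ) * Complex.exp (Complex.I * (φ : ℂ)) ∈ quadrant o A B R rA rB sA sB)
    (φ₁ φ₂ : ℝ) (h₁ : φ₁ ∈ Set.Ioo φA φB) (h₂ : φ₂ ∈ Set.Ioo φA φB) (h₁₂ : φ₁ ≠ φ₂)
    (P₁ P₂ : Piece) (hnd₁ : P₁.Nondeg) (hnd₂ : P₂.Nondeg)
    (hs₁ : P₁.source = p) (hs₂ : P₂.source = p)
    (ht₁ : P₁.target = o + (R : ℂ) * Complex.exp (Complex.I * (φ₁ : ℂ)))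
    (ht₂ : P₂.target = o + (R : ℂ) * Complex.exp (Complex.I * (φ₂ : ℂ)))
    (hin₁ : P₁.image ⊆ quadrant o A B R rA rB sA sB)
    (hin₂ : P₂.image ⊆ quadrant o A B R rA rB sA sB)
    (hagree : φ₁ < φ₂ ↔ 0 < ((starRingEnd ℂ) (P₁.tangent 0) * P₂.tangent 0).im) :
    P₁.image ∩ P₂.image ∩ interior (quadrant o A B R rA rB sA sB) ⊆ {p} := by
  have hD : 0 < R ^ 2 - Complex.normSq (p - o) := by
    have h1 : Complex.normSq (p - o) = dist p o ^ 2 := by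
      rw [Complex.dist_eq, Complex.sq_norm]
    rw [h1]
    have : 0 ≤ dist p o := dist_nonneg
    nlinarith
  have sideA : ∀ z ∈ quadrant o A B R rA rB sA sB, sg sA * (dist z A ^ 2 - rA ^ 2) ≤ 0 :=
    fun z hz => side_of_mem sA z A rA hrA hz.1.2
  have sideB : ∀ z ∈ quadrant o A B R rA rB sA sB, sg sB * (dist z B ^ 2 - rB ^ 2) ≤ 0 :=
    fun z hz => side_of_mem sB z B rB hrB hz.2
  have hsA : ((sg sA : ℝ) : ℂ) ≠ 0 := by
    rcases sg_ne sA with h | h <;> rw [h] <;> norm_num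
  have hsB : ((sg sB : ℝ) : ℂ) ≠ 0 := by
    rcases sg_ne sB with h | h <;> rw [h] <;> norm_num
  have hAp : A - p ≠ 0 := by
    intro h
    rw [sub_eq_zero.1 h, dist_self] at hpA; linarith
  have hBp : B - p ≠ 0 := by
    intro h
    rw [sub_eq_zero.1 h, dist_self] at hpB; linarith
  set α : ℂ := (sg sA : ℂ) * (A - p) with hαd
  set β : ℂ := (sg sB : ℂ) * (B - p) with hβd
  have hα : α ≠ 0 := mul_ne_zero hsA hAp
  have hβ : β ≠ 0 := mul_ne_zero hsB hBp
  have hαβ : dotp α β = 0 := by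
    have h1 : dist p A ^ 2 = rA ^ 2 := by rw [hpA]
    have h2 : dist p B ^ 2 = rB ^ 2 := by rw [hpB]
    rw [dist_sq_eq] at h1 h2 hAB
    simp only [hαd, hβd, dotp, Complex.re_ofReal_mul, Complex.im_ofReal_mul, Complex.sub_re,
      Complex.sub_im]
    linear_combination (sg sA * sg sB / 2) * (h1 + h2 - hAB)
  have dα : ∀ v, dotp α v = sg sA * dotp (A - p) v := by
    intro v
    simp only [hαd, dotp, Complex.re_ofReal_mul, Complex.im_ofReal_mul]; ring
  have dβ : ∀ v, dotp β v = sg sB * dotp (B - p) v := by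
    intro v
    simp only [hβd, dotp, Complex.re_ofReal_mul, Complex.im_ofReal_mul]; ring
  have hbp : ∀ φ : ℝ, o + (R : ℂ) * Complex.exp (Complex.I * (φ : ℂ)) ≠ p := by
    intro φ h
    have h1 := (bU_form R o p φ hR hD).1
    rw [Complex.normSq_pos] at h1
    apply h1
    rw [← h]; ring
  have hUα : ∀ φ ∈ Set.Icc φA φB, 0 ≤ dotp α (bU R o p φ) := fun φ hφ' =>
    cone_of_point (sg sA) o A p _ R rA hAC hpA hD (hbp φ) (sideA _ (harc φ hφ'))
  have hUβ : ∀ φ ∈ Set.Icc φA φB, 0 ≤ dotp β (bU R o p φ) := fun φ hφ' =>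
    cone_of_point (sg sB) o B p _ R rB hBC hpB hD (hbp φ) (sideB _ (harc φ hφ'))
  have hcr : ∀ x ∈ Set.Ioo φA φB, ∀ y ∈ Set.Ioo φA φB, x < y →
      0 < crs (bU R o p x) (bU R o p y) := by
    intro x hx y hy hxy
    refine crs_bU_pos R o p x y hR hD hxy (by linarith [hx.1, hy.2]) ?_
    intro φ hφ'
    have m1 : x ∈ Set.Icc φA φB := ⟨hx.1.le, hx.2.le⟩
    have m2 : φ ∈ Set.Icc φA φB := ⟨by linarith [hx.1, hφ'.1], by linarith [hy.2, hφ'.2]⟩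
    exact dotp_nonneg_of_cone α β _ _ hα hβ hαβ (hUα _ m1) (hUβ _ m1) (hUα _ m2) (hUβ _ m2)
  have hpiece : ∀ P : Piece, P.Nondeg → P.source = p →
      P.image ⊆ quadrant o A B R rA rB sA sB →
      0 ≤ dotp α (P.tangent 0) ∧ 0 ≤ dotp β (P.tangent 0) ∧
      ∀ z ∈ P.image, z ≠ p →
        ∃ l : ℝ, 0 ≤ l ∧ invN p z = invN p P.target + (l : ℂ) * P.tangent 0 := by
    intro P hnd hs hin
    refine ⟨?_, ?_, ?_⟩
    · rw [dα]; exact cone_of_piece P p A rA _ hs hpA (fun z hz => sideA z (hin hz))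
    · rw [dβ]; exact cone_of_piece P p B rB _ hs hpB (fun z hz => sideB z (hin hz))
    · intro z hz hzp
      refine ray_of_piece P p hs hnd ?_ z hz hzp
      intro c r θ₀ θ₁ hP
      by_contra hlong
      rw [not_lt] at hlong
      subst hP
      have z1 := cone_zero_of_long c r θ₀ θ₁ p A rA (sg sA) hs hlong hpA
        (fun z hz => sideA z (hin hz))
      have z2 := cone_zero_of_long c r θ₀ θ₁ p B rB (sg sB) hs hlong hpB
        (fun z hz => sideB z (hin hz))
      rw [← dα] at z1
      rw [← dβ] at z2
      exact tangent_ne _ hnd (eq_zero_of_dotp α β _ hα hβ hαβ z1 z2)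
  obtain ⟨c1, d1, r1⟩ := hpiece P₁ hnd₁ hs₁ hin₁
  obtain ⟨c2, d2, r2⟩ := hpiece P₂ hnd₂ hs₂ hin₂
  have m1 : φ₁ ∈ Set.Icc φA φB := ⟨h₁.1.le, h₁.2.le⟩
  have m2 : φ₂ ∈ Set.Icc φA φB := ⟨h₂.1.le, h₂.2.le⟩
  have ecr : ((starRingEnd ℂ) (P₁.tangent 0) * P₂.tangent 0).im
      = crs (P₁.tangent 0) (P₂.tangent 0) := by
    rw [Complex.mul_im]; simp only [crs, Complex.conj_re, Complex.conj_im]; ring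
  rw [ecr] at hagree
  rintro z ⟨⟨hz1, hz2⟩, -⟩
  by_contra hzp
  obtain ⟨l1, hl1, e1⟩ := r1 z hz1 hzp
  obtain ⟨l2, hl2, e2⟩ := r2 z hz2 hzp
  have hmeet : bU R o p φ₁ + l1 * P₁.tangent 0 = bU R o p φ₂ + l2 * P₂.tangent 0 := by
    rw [ht₁] at e1
    rw [ht₂] at e2
    simp only [bU]
    linear_combination e2 - e1
  have hnn : dotp (bU R o p φ₁) (bU R o p φ₁) = dotp (bU R o p φ₂) (bU R o p φ₂) := by
    rw [bU_norm R o p φ₁ hR hD, bU_norm R o p φ₂ hR hD]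
  rcases lt_or_gt_of_ne h₁₂ with h | h
  · exact no_meet α β _ _ _ _ hα hβ hαβ (hUα _ m1) (hUβ _ m1) (hUα _ m2) (hUβ _ m2) c2 d2
      (tangent_ne _ hnd₂) hnn (hcr _ h₁ _ h₂ h) (hagree.1 h).le l1 l2 hl1 hmeet
  · have hc : crs (P₁.tangent 0) (P₂.tangent 0) ≤ 0 := by
      by_contra hc
      exact absurd (hagree.2 (not_le.1 hc)) (not_lt.2 h.le)
    have hc' : 0 ≤ crs (P₂.tangent 0) (P₁.tangent 0) := by
      simp only [crs] at hc ⊢; linarith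
    exact no_meet α β _ _ _ _ hα hβ hαβ (hUα _ m2) (hUβ _ m2) (hUα _ m1) (hUβ _ m1) c1 d1
      (tangent_ne _ hnd₁) hnn.symm (hcr _ h₂ _ h₁ h) hc' l2 l1 hl2 hmeet.symm
end
end

section
/- Given a circle C and a set P of n points on C, there exists a point p inside C and n circular arcs connecting p to the points of P such that all arcs lie entirely inside the closed disk bounded by C, no two arcs cross, and the tangent directions of the arcs at p are equally spaced at angles of 360/n degrees. -/
open Set Metric

noncomputable section

lemma piece_exists (p w : ℂ) (α : ℝ)
    (hw : w * Complex.exp (-(α * Complex.I)) ∈ Complex.slitPlane) :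
    ∃ Q : Piece, Q.Nondeg ∧ Q.source = p ∧ Q.target = p + w ∧
      dirAngle (Q.tangent 0) = (α : Real.Angle) ∧
      ∀ z ∈ Q.image, z = p ∨ ∃ s : ℝ, 0 ≤ s ∧
        (z - p)⁻¹ = w⁻¹ + s * Complex.exp (-(α * Complex.I)) := by
  set v := w * Complex.exp (-(α * Complex.I)) with hv
  have hv0 : v ≠ 0 := Complex.slitPlane_ne_zero hw
  have hwv : w = v * Complex.exp (α * Complex.I) := by
    rw [hv, mul_assoc, ← Complex.exp_add]; simp
  have hw0 : w ≠ 0 := by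
    intro h; apply hv0; rw [hv, h, zero_mul]
  set δ := Complex.arg v with hδ
  have hρ : 0 < ‖v‖ := norm_pos_iff.mpr hv0
  have hpol : (‖v‖ : ℂ) * Complex.exp (δ * Complex.I) = v := Complex.norm_mul_exp_arg_mul_I v
  have hdir : ∀ r : ℝ, 0 < r →
      dirAngle (r * Complex.exp (α * Complex.I)) = (α : Real.Angle) := by
    intro r hr
    unfold dirAngle
    rw [Complex.exp_mul_I]
    have := Complex.arg_mul_cos_add_sin_mul_I_coe_angle hr (α : Real.Angle)
    simpa using this
  have hpi : δ ≠ Real.pi := (Complex.mem_slitPlane_iff_arg.mp hw).1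
  have hlt : δ < Real.pi := lt_of_le_of_ne (Complex.arg_le_pi v) hpi
  have hgt : -Real.pi < δ := Complex.neg_pi_lt_arg v
  by_cases h0 : δ = 0
  · rw [h0] at hpol
    simp only [Complex.ofReal_zero, zero_mul, Complex.exp_zero, mul_one] at hpol
    have hwr : w = (‖v‖ : ℂ) * Complex.exp (α * Complex.I) := by rw [hpol]; exact hwv
    have hinv : w⁻¹ = (‖v‖ : ℂ)⁻¹ * Complex.exp (-(α * Complex.I)) := by
      rw [hwr, mul_inv, Complex.exp_neg]
    refine ⟨Piece.seg p (p + w), ?_, ?_, ?_, ?_, ?_⟩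
    · simpa [Piece.Nondeg] using hw0
    · simp [Piece.source, Piece.toFun]
    · simp [Piece.target, Piece.toFun]
    · have := hdir ‖v‖ hρ
      rw [← hwr] at this
      simpa [Piece.tangent] using this
    · rintro z ⟨t, ⟨ht0, ht1⟩, rfl⟩
      rcases eq_or_lt_of_le ht0 with h | h
      · left; simp [Piece.toFun, ← h]
      · right
        refine ⟨(t⁻¹ - 1) * ‖v‖⁻¹, ?_, ?_⟩
        · have : 1 ≤ t⁻¹ := (one_le_inv₀ h).mpr ht1
          have h2 : 0 ≤ t⁻¹ - 1 := by linarith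
          positivity
        · simp only [Piece.toFun, add_sub_cancel_left, mul_inv]
          rw [hinv]; push_cast; ring
  · have hs : Real.sin δ ≠ 0 := by
      rcases lt_or_gt_of_ne h0 with h | h
      · exact (Real.sin_neg_of_neg_of_neg_pi_lt h hgt).ne
      · exact (Real.sin_pos_of_pos_of_lt_pi h hlt).ne'
    have hratio : ∀ t : ℝ, 0 < t → t ≤ 1 →
        Real.sin (δ * t) ≠ 0 ∧ 0 ≤ Real.sin (δ - δ * t) / Real.sin (δ * t) := by
      intro t h0t ht1
      rcases lt_or_gt_of_ne h0 with h | h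
      · have h1 : Real.sin (δ * t) < 0 :=
          Real.sin_neg_of_neg_of_neg_pi_lt (by nlinarith) (by nlinarith)
        refine ⟨h1.ne, div_nonneg_of_nonpos ?_ h1.le⟩
        exact Real.sin_nonpos_of_nonpos_of_neg_pi_le (by nlinarith) (by nlinarith)
      · have h1 : 0 < Real.sin (δ * t) :=
          Real.sin_pos_of_pos_of_lt_pi (by nlinarith) (by nlinarith)
        refine ⟨h1.ne', div_nonneg ?_ h1.le⟩
        exact Real.sin_nonneg_of_nonneg_of_le_pi (by nlinarith) (by nlinarith)
    set r : ℝ := ‖v‖ / (2 * Real.sin δ) with hr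
    have hr0 : r ≠ 0 := div_ne_zero hρ.ne' (mul_ne_zero two_ne_zero hs)
    have hrδ : 0 < r * (2 * δ) := by
      have : r * (2 * δ) = ‖v‖ * (δ / Real.sin δ) := by rw [hr]; field_simp
      rw [this]
      apply mul_pos hρ
      rcases lt_or_gt_of_ne h0 with h | h
      · exact div_pos_of_neg_of_neg h (Real.sin_neg_of_neg_of_neg_pi_lt h hgt)
      · exact div_pos h (Real.sin_pos_of_pos_of_lt_pi h hlt)
    have hE : Complex.exp (Complex.I * ((α - Real.pi / 2 : ℝ) : ℂ))
        = -Complex.I * Complex.exp (α * Complex.I) := by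
      have : Complex.I * ((α - Real.pi / 2 : ℝ) : ℂ)
          = -(Real.pi / 2 * Complex.I) + α * Complex.I := by push_cast; ring
      rw [this, Complex.exp_add, Complex.exp_neg, Complex.exp_pi_div_two_mul_I]
      simp
    set Q : Piece := Piece.arc (p + r * Complex.I * Complex.exp (α * Complex.I)) r
      (α - Real.pi / 2) (α - Real.pi / 2 + 2 * δ) with hQ
    have hfun : ∀ t : ℝ, Q.toFun t = p + ((‖v‖ * (Real.sin (δ * t) / Real.sin δ) : ℝ) : ℂ) *
        (Complex.exp (α * Complex.I) * Complex.exp ((δ * t : ℝ) * Complex.I)) := by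
      intro t
      have h1 : Complex.I * ((α - Real.pi / 2 + t * (α - Real.pi / 2 + 2 * δ - (α - Real.pi / 2)) : ℝ) : ℂ)
          = Complex.I * ((α - Real.pi / 2 : ℝ) : ℂ) + ((δ * t : ℝ) * Complex.I + (δ * t : ℝ) * Complex.I) := by
        push_cast; ring
      simp only [hQ, Piece.toFun]
      rw [h1, Complex.exp_add, Complex.exp_add, hE, hr, Complex.exp_mul_I ((δ * t : ℝ) : ℂ),
        ← Complex.ofReal_cos, ← Complex.ofReal_sin]
      have hsc : ((Real.sin (δ * t) : ℝ) : ℂ)^2 + ((Real.cos (δ * t) : ℝ) : ℂ)^2 = 1 := by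
        exact_mod_cast Real.sin_sq_add_cos_sq (δ * t)
      have hsC : ((Real.sin δ : ℝ) : ℂ) ≠ 0 := by exact_mod_cast hs
      generalize Real.sin (δ * t) = S at *
      generalize Real.cos (δ * t) = C at *
      generalize Complex.exp (α * Complex.I) = E at *
      generalize ‖v‖ = V at *
      have hI := Complex.I_sq
      generalize Real.sin δ = D at *
      push_cast
      field_simp
      linear_combination (-Complex.I * V * E) * hsc + (V * E * (-2 * C * S - Complex.I * S ^ 2)) * hI
    refine ⟨Q, ?_, ?_, ?_, ?_, ?_⟩
    · refine ⟨hr0, ?_⟩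
      intro h; apply h0; linarith
    · rw [Piece.source, hfun]; simp
    · rw [Piece.target, hfun, mul_one, div_self hs, mul_one]
      rw [mul_comm (Complex.exp _), ← mul_assoc, hpol, ← hwv]
    · have := hdir _ hrδ
      rw [← this]
      congr 1
      simp only [hQ, Piece.tangent, zero_mul, add_zero]
      rw [hE]
      push_cast
      have hI := Complex.I_sq
      linear_combination (-2 * r * δ * Complex.exp (α * Complex.I)) * hI
    · rintro z ⟨t, ⟨ht0, ht1⟩, rfl⟩
      rcases eq_or_lt_of_le ht0 with h | h
      · left; rw [hfun, ← h]; simp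
      · right
        obtain ⟨h1, h2⟩ := hratio t h ht1
        refine ⟨‖v‖⁻¹ * (Real.sin (δ - δ * t) / Real.sin (δ * t)), by positivity, ?_⟩
        have hinv : w⁻¹ = (‖v‖ : ℂ)⁻¹ * Complex.exp (-(δ * Complex.I)) *
            Complex.exp (-(α * Complex.I)) := by
          rw [hwv, mul_inv, Complex.exp_neg, Complex.exp_neg, ← mul_inv (‖v‖ : ℂ), hpol]
        rw [hfun, add_sub_cancel_left, mul_inv, mul_inv, ← Complex.exp_neg, ← Complex.exp_neg, hinv,
          ← neg_mul (δ : ℂ), ← neg_mul ((δ * t : ℝ) : ℂ), Complex.exp_mul_I, Complex.exp_mul_I,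
          Real.sin_sub]
        simp only [Complex.cos_neg, Complex.sin_neg]
        rw [← Complex.ofReal_cos, ← Complex.ofReal_sin, ← Complex.ofReal_cos, ← Complex.ofReal_sin]
        have hsC : ((Real.sin δ : ℝ) : ℂ) ≠ 0 := by exact_mod_cast hs
        have hsC' : ((Real.sin (δ * t) : ℝ) : ℂ) ≠ 0 := by exact_mod_cast h1
        have hvC : ((‖v‖ : ℝ) : ℂ) ≠ 0 := by exact_mod_cast hρ.ne'
        have hsc : ((Real.sin (δ) : ℝ) : ℂ)^2 + ((Real.cos (δ) : ℝ) : ℂ)^2 = 1 := by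
          exact_mod_cast Real.sin_sq_add_cos_sq (δ)
        generalize Real.sin (δ * t) = S at *
        generalize Real.cos (δ * t) = C at *
        generalize Real.sin (δ) = S' at *
        generalize Real.cos (δ) = C' at *
        generalize ‖v‖ = V at *
        push_cast at *
        field_simp
        ring

lemma arcsin_contr (ρ : ℝ) (hρ : 1 ≤ ρ) (a b : ℝ) (ha : -(Real.pi / 2) ≤ a) (hab : a ≤ b)
    (hb : b ≤ Real.pi / 2) :
    0 ≤ Real.arcsin (Real.sin b / ρ) - Real.arcsin (Real.sin a / ρ) ∧
    Real.arcsin (Real.sin b / ρ) - Real.arcsin (Real.sin a / ρ) ≤ b - a := by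
  constructor
  · have : Real.sin a ≤ Real.sin b := Real.sin_le_sin_of_le_of_le_pi_div_two ha hb hab
    have : Real.arcsin (Real.sin a / ρ) ≤ Real.arcsin (Real.sin b / ρ) := by
      apply Real.monotone_arcsin
      gcongr
    linarith
  · rcases eq_or_lt_of_le hρ with h | h
    · rw [← h, div_one, div_one, Real.arcsin_sin ha (by linarith), Real.arcsin_sin (by linarith) hb]
    · have hmono : MonotoneOn (fun x => x - Real.arcsin (Real.sin x / ρ))
          (Icc (-(Real.pi / 2)) (Real.pi / 2)) := by
        have hd : ∀ x : ℝ, HasDerivAt (fun x => x - Real.arcsin (Real.sin x / ρ))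
            (1 - 1 / √(1 - (Real.sin x / ρ) ^ 2) * (Real.cos x / ρ)) x := by
          intro x
          have hlt : |Real.sin x / ρ| < 1 := by
            rw [abs_div, abs_of_pos (by linarith : (0:ℝ) < ρ), div_lt_one (by linarith)]
            exact lt_of_le_of_lt (Real.abs_sin_le_one x) h
          rw [abs_lt] at hlt
          have h1 := (Real.hasDerivAt_arcsin hlt.1.ne' hlt.2.ne).comp x
            ((Real.hasDerivAt_sin x).div_const ρ)
          exact (hasDerivAt_id x).sub h1
        apply monotoneOn_of_deriv_nonneg (convex_Icc _ _)
        · exact fun x _ => (hd x).continuousAt.continuousWithinAt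
        · exact fun x _ => (hd x).differentiableAt.differentiableWithinAt
        · intro x hx
          rw [(hd x).deriv]
          have hρ0 : 0 < ρ := by linarith
          have key : Real.cos x / ρ ≤ √(1 - (Real.sin x / ρ) ^ 2) := by
            apply Real.le_sqrt_of_sq_le
            have := Real.sin_sq_add_cos_sq x
            have e : (Real.cos x / ρ)^2 + (Real.sin x / ρ)^2 = 1 / ρ^2 := by
              field_simp; linarith
            have : 1 / ρ ^ 2 ≤ 1 := by
              rw [div_le_one (by positivity)]; nlinarith
            linarith
          rw [one_div, inv_mul_eq_div, sub_nonneg]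
          exact div_le_one_of_le₀ key (Real.sqrt_nonneg _)
      have := hmono ⟨ha, by linarith⟩ ⟨by linarith, hb⟩ hab
      simp only at this
      linarith

lemma ray_polar (φ α s : ℝ) (hs : 0 ≤ s) (h : |α - φ| ≤ Real.pi / 2) :
    1 ≤ ‖Complex.exp (φ * Complex.I) + s * Complex.exp (α * Complex.I)‖ ∧
    Complex.exp (φ * Complex.I) + s * Complex.exp (α * Complex.I) =
      ‖Complex.exp (φ * Complex.I) + s * Complex.exp (α * Complex.I)‖ *
      Complex.exp ((α - Real.arcsin (Real.sin (α - φ) /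
        ‖Complex.exp (φ * Complex.I) + s * Complex.exp (α * Complex.I)‖) : ℝ) * Complex.I) := by
  set V := Complex.exp (φ * Complex.I) + s * Complex.exp (α * Complex.I) with hV
  rw [abs_le] at h
  have hc : 0 ≤ Real.cos (α - φ) := Real.cos_nonneg_of_mem_Icc h
  set W : ℂ := Complex.exp (((-(α - φ) : ℝ) : ℂ) * Complex.I) + s with hW
  have hVW : V = Complex.exp (α * Complex.I) * W := by
    rw [hW, mul_add, ← Complex.exp_add, hV]
    push_cast
    ring_nf
  have hre : W.re = Real.cos (α - φ) + s := by
    rw [hW, Complex.add_re, Complex.exp_ofReal_mul_I_re, Real.cos_neg, Complex.ofReal_re]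
  have him : W.im = -Real.sin (α - φ) := by
    rw [hW, Complex.add_im, Complex.exp_ofReal_mul_I_im, Real.sin_neg, Complex.ofReal_im, add_zero]
  have hn : ‖V‖ = ‖W‖ := by
    rw [hVW, norm_mul, Complex.norm_exp_ofReal_mul_I, one_mul]
  have harg : W.arg = - Real.arcsin (Real.sin (α - φ) / ‖V‖) := by
    rw [Complex.arg_of_re_nonneg (by rw [hre]; positivity), him, hn, neg_div, Real.arcsin_neg]
  constructor
  · rw [hn]
    have : 1 ≤ ‖W‖ ^ 2 := by
      rw [← Complex.normSq_eq_norm_sq, Complex.normSq_apply, hre, him]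
      nlinarith [Real.sin_sq_add_cos_sq (α - φ)]
    nlinarith [norm_nonneg W]
  · rw [sub_eq_add_neg, ← harg, hn]
    push_cast
    rw [add_mul, Complex.exp_add, mul_left_comm, Complex.norm_mul_exp_arg_mul_I, hVW]

lemma rays_disjoint (φ₁ φ₂ α₁ α₂ s₁ s₂ : ℝ) (hs₁ : 0 ≤ s₁) (hs₂ : 0 ≤ s₂)
    (h₁ : |α₁ - φ₁| ≤ Real.pi / 2) (h₂ : |α₂ - φ₂| ≤ Real.pi / 2)
    (hφ : φ₁ < φ₂) (hφ' : φ₂ < φ₁ + 2 * Real.pi)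
    (hα : α₁ < α₂) (hα' : α₂ < α₁ + 2 * Real.pi) :
    Complex.exp (φ₁ * Complex.I) + s₁ * Complex.exp (α₁ * Complex.I) ≠
    Complex.exp (φ₂ * Complex.I) + s₂ * Complex.exp (α₂ * Complex.I) := by
  intro heq
  obtain ⟨hρ, e1⟩ := ray_polar φ₁ α₁ s₁ hs₁ h₁
  obtain ⟨-, e2⟩ := ray_polar φ₂ α₂ s₂ hs₂ h₂
  rw [← heq] at e2
  set ρ := ‖Complex.exp (φ₁ * Complex.I) + s₁ * Complex.exp (α₁ * Complex.I)‖
  have hρ0 : (ρ : ℂ) ≠ 0 := by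
    have : ρ ≠ 0 := by linarith
    exact_mod_cast this
  rw [e1] at e2
  have e3 := mul_left_cancel₀ hρ0 e2
  rw [Complex.exp_eq_exp_iff_exists_int] at e3
  obtain ⟨m, hm⟩ := e3
  have hm' : α₁ - Real.arcsin (Real.sin (α₁ - φ₁) / ρ) =
      α₂ - Real.arcsin (Real.sin (α₂ - φ₂) / ρ) + m * (2 * Real.pi) := by
    have := congrArg Complex.im hm
    simpa using this
  rw [abs_le] at h₁ h₂
  have hpi := Real.pi_pos
  have hb : 0 < -(m * (2 * Real.pi)) ∧ -(m * (2 * Real.pi)) < 2 * Real.pi := by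
    rcases le_total (α₁ - φ₁) (α₂ - φ₂) with h | h
    · obtain ⟨a, b⟩ := arcsin_contr ρ hρ _ _ h₁.1 h h₂.2
      constructor <;> linarith
    · obtain ⟨a, b⟩ := arcsin_contr ρ hρ _ _ h₂.1 h h₁.2
      constructor <;> linarith
  have m1 : (m : ℝ) < 0 := by nlinarith
  have m2 : (-1 : ℝ) < m := by nlinarith
  have m1' : m < 0 := by exact_mod_cast m1
  have m2' : -1 < m := by exact_mod_cast m2
  omega

lemma arc_contra (n K : ℕ) (M : ℝ) (c : Fin n → ℝ) (hsum : n ≤ 2 ∨ ∑ i, c i = 0)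
    (hM : 0 ≤ M) (hMK : M / 2 < Real.pi * K / n - Real.pi / 2) (hK : K < n)
    (S : Finset (Fin n)) (hS : S.card = K + 1)
    (hc : ∀ i, -1 ≤ c i) (hcS : ∀ i ∈ S, Real.cos (M / 2) ≤ c i) : False := by
  have hpi := Real.pi_pos
  have hn : (0 : ℝ) < n := by exact_mod_cast (by omega : 0 < n)
  have hKn : (K : ℝ) + 1 ≤ n := by exact_mod_cast hK
  have h2K : (n : ℝ) < 2 * K := by
    have h1 : Real.pi / 2 < Real.pi * K / n := by linarith
    rw [lt_div_iff₀ hn] at h1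
    nlinarith
  have h2K' : n < 2 * K := by exact_mod_cast h2K
  rcases hsum with h | hsum
  · omega
  have hC : 2 * (n - K) / n ≤ Real.cos (M / 2) := by
    have e : Real.cos (Real.pi * K / n - Real.pi / 2) = Real.sin (Real.pi * (n - K) / n) := by
      rw [Real.cos_sub_pi_div_two, ← Real.sin_pi_sub]
      congr 1; field_simp
    have h1 : Real.cos (Real.pi * K / n - Real.pi / 2) ≤ Real.cos (M / 2) := by
      apply Real.cos_le_cos_of_nonneg_of_le_pi (by linarith) _ hMK.le
      have : Real.pi * K / n ≤ Real.pi := by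
        rw [div_le_iff₀ hn]; nlinarith
      linarith
    have h2 := Real.mul_le_sin (x := Real.pi * (n - K) / n)
      (by apply div_nonneg _ hn.le; apply mul_nonneg hpi.le; linarith)
      (by rw [div_le_iff₀ hn]; nlinarith)
    have h3 : 2 / Real.pi * (Real.pi * (n - K) / n) = 2 * (n - K) / n := by field_simp
    linarith
  have hlow : (K + 1 : ℝ) * (Real.cos (M / 2)) - (n - (K + 1)) ≤ ∑ i, c i := by
    rw [← Finset.sum_add_sum_compl S]
    have h1 : S.card • Real.cos (M / 2) ≤ ∑ i ∈ S, c i := Finset.card_nsmul_le_sum _ _ _ hcS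
    have h2 : Sᶜ.card • (-1 : ℝ) ≤ ∑ i ∈ Sᶜ, c i :=
      Finset.card_nsmul_le_sum _ _ _ (fun i _ => hc i)
    rw [Finset.card_compl, Fintype.card_fin, hS, nsmul_eq_mul, Nat.cast_sub (by omega)] at h2
    rw [hS, nsmul_eq_mul] at h1
    push_cast at h1 h2
    linarith
  have h4 : (K + 1 : ℝ) * (2 * (n - K) / n) ≥ n - K := by
    have : (K + 1 : ℝ) * (2 * (n - K) / n) = ((K + 1) * (2 * (n - K))) / n := by ring
    rw [this, ge_iff_le, le_div_iff₀ hn]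
    nlinarith
  nlinarith

lemma sorted_osc (n : ℕ) (φ : Fin n → ℝ) (hφ : StrictMono φ)
    (hr : ∀ i j, φ i < φ j + 2 * Real.pi)
    (hsum : n ≤ 2 ∨ ∀ m : ℝ, ∑ i, Real.cos (φ i - m) = 0) (j k : Fin n) :
    (φ k - 2 * Real.pi * (k : ℕ) / n) - (φ j - 2 * Real.pi * (j : ℕ) / n) ≤ Real.pi := by
  have hpi := Real.pi_pos
  have hn : (0 : ℝ) < n := by exact_mod_cast (Fin.pos j)
  by_contra hcon
  push Not at hcon
  rcases lt_trichotomy j k with h | h | h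
  · -- complement arc
    have hv : (j : ℕ) < k := h
    have hk := k.2
    have hjk := hφ h
    refine arc_contra n (n - (k - j)) (2 * Real.pi - (φ k - φ j))
      (fun i => Real.cos (φ i - ((φ k + φ j) / 2 + Real.pi))) ?_ ?_ ?_ (by omega)
      (Finset.univ.filter (fun i => i ≤ j ∨ k ≤ i)) ?_ (fun i => Real.neg_one_le_cos _) ?_
    · exact hsum.imp id (fun h => h _)
    · have := hr k j; linarith
    · rw [Nat.cast_sub (by omega), Nat.cast_sub (by omega)]
      have : Real.pi * (n - ((k : ℕ) - (j : ℕ) : ℝ)) / n = Real.pi - Real.pi * (k : ℕ) / n + Real.pi * (j : ℕ) / n := by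
        field_simp; ring
      rw [this]
      have e1 : 2 * Real.pi * (k : ℕ) / n = 2 * (Real.pi * (k : ℕ) / n) := by ring
      have e2 : 2 * Real.pi * (j : ℕ) / n = 2 * (Real.pi * (j : ℕ) / n) := by ring
      rw [e1, e2] at hcon
      linarith
    · have : (Finset.univ.filter (fun i => i ≤ j ∨ k ≤ i)) = (Finset.Ioo j k)ᶜ := by
        ext i; simp; grind
      rw [this, Finset.card_compl, Fin.card_Ioo, Fintype.card_fin]
      omega
    · intro i hi
      simp only [Finset.mem_filter, Finset.mem_univ, true_and] at hi
      rw [show φ i - ((φ k + φ j) / 2 + Real.pi) = (φ i - (φ k + φ j) / 2) - Real.pi by ring,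
        Real.cos_sub_pi,
        show (2 * Real.pi - (φ k - φ j)) / 2 = Real.pi - (φ k - φ j) / 2 by ring, Real.cos_pi_sub]
      apply neg_le_neg
      have hkj := hr k j
      rcases hi with hi | hi
      · have h1 := hφ.monotone hi
        have h2 := hr k i
        rw [← Real.cos_neg]
        rcases le_total (-(φ i - (φ k + φ j) / 2)) Real.pi with h3 | h3
        · exact Real.cos_le_cos_of_nonneg_of_le_pi (by linarith) h3 (by linarith)
        · rw [← Real.cos_two_pi_sub]
          exact Real.cos_le_cos_of_nonneg_of_le_pi (by linarith) (by linarith) (by linarith)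
      · have h1 := hφ.monotone hi
        have h2 := hr i j
        rcases le_total ((φ i - (φ k + φ j) / 2)) Real.pi with h3 | h3
        · exact Real.cos_le_cos_of_nonneg_of_le_pi (by linarith) h3 (by linarith)
        · rw [← Real.cos_two_pi_sub]
          exact Real.cos_le_cos_of_nonneg_of_le_pi (by linarith) (by linarith) (by linarith)
  · subst h; linarith
  · have hv : (k : ℕ) < j := h
    have hk := j.2
    have hjk := hφ h
    refine arc_contra n (j - k) (φ j - φ k)
      (fun i => Real.cos (φ i - ((φ k + φ j) / 2))) ?_ ?_ ?_ (by omega)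
      (Finset.Icc k j) ?_ (fun i => Real.neg_one_le_cos _) ?_
    · exact hsum.imp id (fun h => h _)
    · linarith
    · rw [Nat.cast_sub (by omega)]
      have : Real.pi * (((j : ℕ) - (k : ℕ) : ℝ)) / n = Real.pi * (j : ℕ) / n - Real.pi * (k : ℕ) / n := by
        ring
      rw [this]
      have e1 : 2 * Real.pi * (k : ℕ) / n = 2 * (Real.pi * (k : ℕ) / n) := by ring
      have e2 : 2 * Real.pi * (j : ℕ) / n = 2 * (Real.pi * (j : ℕ) / n) := by ring
      rw [e1, e2] at hcon
      linarith
    · rw [Fin.card_Icc]; omega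
    · intro i hi
      rw [Finset.mem_Icc] at hi
      have h1 := hφ.monotone hi.1
      have h2 := hφ.monotone hi.2
      have h3 := hr j k
      rw [← Real.cos_abs (φ i - _)]
      apply Real.cos_le_cos_of_nonneg_of_le_pi (abs_nonneg _) (by linarith)
      rw [abs_le]; constructor <;> linarith

/-- Sorting the unit vectors `u x` by angle, and matching with equally spaced directions. -/
lemma exists_matching (P : Finset ℂ) (hne : P.Nonempty) (u : ℂ → ℂ)
    (hinj : Set.InjOn u P) (hu : ∀ x ∈ P, ‖u x‖ = 1)
    (hsum : P.card ≤ 2 ∨ ∑ x ∈ P, u x = 0) :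
    ∃ (θ : ℝ) (e : {x // x ∈ P} ≃ Fin P.card) (φ : Fin P.card → ℝ), StrictMono φ ∧
      (∀ i j, φ i < φ j + 2 * Real.pi) ∧
      (∀ x : {x // x ∈ P}, u x = Complex.exp (φ (e x) * Complex.I)) ∧
      ∀ k : Fin P.card, |θ + 2 * Real.pi * (k : ℕ) / P.card - φ k| ≤ Real.pi / 2 := by
  have hpolar : ∀ x ∈ P, u x = Complex.exp (Complex.arg (u x) * Complex.I) := by
    intro x hx
    have := Complex.norm_mul_exp_arg_mul_I (u x)
    rw [hu x hx] at this
    simpa using this.symm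
  have hainj : Set.InjOn (fun x => Complex.arg (u x)) P := by
    intro x hx y hy hxy
    apply hinj hx hy
    rw [hpolar x hx, hpolar y hy]
    simp only at hxy
    rw [hxy]
  set T := P.image (fun x => Complex.arg (u x)) with hT
  have hTc : T.card = P.card := Finset.card_image_of_injOn hainj
  let iso := T.orderIsoOfFin hTc
  let φ : Fin P.card → ℝ := fun k => iso k
  have hφ : StrictMono φ := fun a b hab => by
    have := iso.strictMono hab
    exact this
  let g : {x // x ∈ P} → T := fun x => ⟨Complex.arg (u x), Finset.mem_image_of_mem _ x.2⟩
  have hg : Function.Bijective g := by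
    constructor
    · intro x y hxy
      apply Subtype.ext
      exact hainj x.2 y.2 (congrArg Subtype.val hxy)
    · rintro ⟨t, ht⟩
      obtain ⟨x, hx, hxt⟩ := Finset.mem_image.mp ht
      exact ⟨⟨x, hx⟩, Subtype.ext hxt⟩
  let e : {x // x ∈ P} ≃ Fin P.card := (Equiv.ofBijective g hg).trans iso.symm.toEquiv
  have hφe : ∀ x : {x // x ∈ P}, φ (e x) = Complex.arg (u x) := by
    intro x
    change ((iso (iso.symm (g x)) : T) : ℝ) = _
    rw [OrderIso.apply_symm_apply]
  have hφr : ∀ i, ∃ x : {x // x ∈ P}, φ i = Complex.arg (u x) := by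
    intro i
    exact ⟨e.symm i, by rw [← hφe, Equiv.apply_symm_apply]⟩
  have hr : ∀ i j, φ i < φ j + 2 * Real.pi := by
    intro i j
    obtain ⟨x, hx⟩ := hφr i
    obtain ⟨y, hy⟩ := hφr j
    rw [hx, hy]
    linarith [Complex.arg_le_pi (u x), Complex.neg_pi_lt_arg (u y)]
  have hsum' : P.card ≤ 2 ∨ ∀ m : ℝ, ∑ i, Real.cos (φ i - m) = 0 := by
    refine hsum.imp id (fun h m => ?_)
    rw [← Equiv.sum_comp e, Finset.univ_eq_attach]
    simp only [hφe]
    rw [Finset.sum_attach P (fun x => Real.cos (Complex.arg (u x) - m))]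
    have h1 : ∀ x ∈ P, Real.cos (Complex.arg (u x) - m) =
        (u x * Complex.exp ((-m : ℝ) * Complex.I)).re := by
      intro x hx
      conv_rhs => rw [hpolar x hx]
      rw [← Complex.exp_add, ← add_mul, ← Complex.ofReal_add, Complex.exp_ofReal_mul_I_re]
      rfl
    rw [Finset.sum_congr rfl h1, ← Complex.re_sum, ← Finset.sum_mul, h]
    simp
  have hosc := sorted_osc P.card φ hφ hr hsum'
  have : Nonempty (Fin P.card) := ⟨⟨0, Finset.card_pos.mpr hne⟩⟩
  obtain ⟨a, ha⟩ := Finite.exists_max (fun k : Fin P.card => φ k - 2 * Real.pi * (k : ℕ) / P.card)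
  obtain ⟨b, hb⟩ := Finite.exists_min (fun k : Fin P.card => φ k - 2 * Real.pi * (k : ℕ) / P.card)
  refine ⟨((φ a - 2 * Real.pi * (a : ℕ) / P.card) + (φ b - 2 * Real.pi * (b : ℕ) / P.card)) / 2,
    e, φ, hφ, hr, ?_, ?_⟩
  · intro x
    rw [hφe]; exact hpolar x x.2
  · intro k
    have h1 := ha k
    have h2 := hb k
    have h3 := hosc b a
    rw [abs_le]
    constructor <;> linarith

lemma prod_lower (P : Finset ℂ) (a : ℂ → ℂ) (ρ : ℝ) (hρ : 0 < ρ) (hρ1 : ρ ≤ 1)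
    (ha : ∀ x ∈ P, ‖a x‖ = 1) (hsep : ∀ x ∈ P, ∀ y ∈ P, x ≠ y → 2 * ρ ≤ ‖a x - a y‖)
    (p : ℂ) (hp : ‖p‖ < 1) :
    ρ ^ (2 * P.card) * ((1 - ‖p‖ ^ 2) / 2) ^ 2 ≤ ∏ x ∈ P, ‖a x - p‖ ^ 2 := by
  have hp0 := norm_nonneg p
  have hq0 : 0 ≤ (1 - ‖p‖ ^ 2) / 2 := by nlinarith
  have hq1 : (1 - ‖p‖ ^ 2) / 2 ≤ 1 := by nlinarith
  by_cases h : ∃ x ∈ P, ‖a x - p‖ < ρ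
  · obtain ⟨x, hx, hxp⟩ := h
    rw [← Finset.mul_prod_erase P _ hx]
    have h1 : (ρ ^ 2) ^ (P.erase x).card ≤ ∏ y ∈ P.erase x, ‖a y - p‖ ^ 2 := by
      rw [← Finset.prod_const]
      apply Finset.prod_le_prod
      · intros; positivity
      · intro y hy
        have hs := hsep x hx y (Finset.mem_of_mem_erase hy) (Finset.ne_of_mem_erase hy).symm
        have : ‖a x - a y‖ ≤ ‖a x - p‖ + ‖a y - p‖ := by
          rw [norm_sub_rev (a y) p]
          exact norm_sub_le_norm_sub_add_norm_sub _ _ _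
        gcongr
        linarith
    have h2 : (1 - ‖p‖ ^ 2) / 2 ≤ ‖a x - p‖ := by
      have := norm_sub_norm_le (a x) p
      rw [ha x hx] at this
      nlinarith
    have h3 : ρ ^ (2 * P.card) ≤ (ρ ^ 2) ^ (P.erase x).card := by
      rw [← pow_mul]
      apply pow_le_pow_of_le_one hρ.le hρ1
      have := Finset.card_erase_le (s := P) (a := x)
      omega
    calc ρ ^ (2 * P.card) * ((1 - ‖p‖ ^ 2) / 2) ^ 2
        ≤ (∏ y ∈ P.erase x, ‖a y - p‖ ^ 2) * ‖a x - p‖ ^ 2 := by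
          gcongr
          exact h3.trans h1
      _ = _ := mul_comm _ _
  · push Not at h
    calc ρ ^ (2 * P.card) * ((1 - ‖p‖ ^ 2) / 2) ^ 2
        ≤ ρ ^ (2 * P.card) * 1 := by
          gcongr
          exact pow_le_one₀ hq0 hq1
      _ = ∏ x ∈ P, ρ ^ 2 := by rw [Finset.prod_const, ← pow_mul, mul_one]
      _ ≤ _ := by
        apply Finset.prod_le_prod
        · intros; positivity
        · intro y hy
          have := h y hy
          gcongr

lemma exists_sep (P : Finset ℂ) (a : ℂ → ℂ) (hinj : Set.InjOn a P) :
    ∃ ρ : ℝ, 0 < ρ ∧ ρ ≤ 1 ∧ ∀ x ∈ P, ∀ y ∈ P, x ≠ y → 2 * ρ ≤ ‖a x - a y‖ := by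
  by_cases h : P.offDiag.Nonempty
  · obtain ⟨z, hz, hmin⟩ := Finset.exists_min_image P.offDiag (fun z => ‖a z.1 - a z.2‖) h
    rw [Finset.mem_offDiag] at hz
    have hpos : 0 < ‖a z.1 - a z.2‖ := by
      rw [norm_pos_iff, sub_ne_zero]
      exact fun h => hz.2.2 (hinj hz.1 hz.2.1 h)
    refine ⟨min 1 (‖a z.1 - a z.2‖ / 2), by positivity, min_le_left _ _, ?_⟩
    intro x hx y hy hxy
    have := hmin (x, y) (Finset.mem_offDiag.mpr ⟨hx, hy, hxy⟩)
    have h2 := min_le_right 1 (‖a z.1 - a z.2‖ / 2)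
    simp only at this
    linarith
  · refine ⟨1, one_pos, le_rfl, ?_⟩
    intro x hx y hy hxy
    exact absurd ⟨(x, y), Finset.mem_offDiag.mpr ⟨hx, hy, hxy⟩⟩ h

lemma exists_max_poisson (P : Finset ℂ) (a : ℂ → ℂ) (hinj : Set.InjOn a P)
    (ha : ∀ x ∈ P, ‖a x‖ = 1) (hc : 3 ≤ P.card) :
    ∃ q : ℂ, ‖q‖ < 1 ∧ ∀ p : ℂ, ‖p‖ < 1 →
      (1 - ‖p‖ ^ 2) ^ P.card / ∏ x ∈ P, ‖a x - p‖ ^ 2 ≤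
      (1 - ‖q‖ ^ 2) ^ P.card / ∏ x ∈ P, ‖a x - q‖ ^ 2 := by
  obtain ⟨ρ, hρ, hρ1, hsep⟩ := exists_sep P a hinj
  set G : ℂ → ℝ := fun p => (1 - ‖p‖ ^ 2) ^ P.card / ∏ x ∈ P, ‖a x - p‖ ^ 2 with hG
  have hG0 : G 0 = 1 := by
    simp only [hG, norm_zero, sub_zero]
    rw [Finset.prod_eq_one]
    · simp
    · intro x hx; rw [ha x hx]; norm_num
  have hprod : ∀ p : ℂ, ‖p‖ < 1 → 0 < ∏ x ∈ P, ‖a x - p‖ ^ 2 := by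
    intro p hp
    apply Finset.prod_pos
    intro x hx
    have : 0 < ‖a x - p‖ := by
      have := norm_sub_norm_le (a x) p
      rw [ha x hx] at this
      linarith
    positivity
  set κ := ρ ^ (2 * P.card) / 4 with hκ
  have hκ0 : 0 < κ := by positivity
  have hκ1 : κ ≤ 1 := by
    have : ρ ^ (2 * P.card) ≤ 1 := pow_le_one₀ hρ.le hρ1
    rw [hκ]; linarith
  have hsmall : ∀ p : ℂ, ‖p‖ < 1 → 1 - ‖p‖ ^ 2 < κ → G p ≤ 1 := by
    intro p hp hpk
    have hp0 := norm_nonneg p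
    have hb : 0 < 1 - ‖p‖ ^ 2 := by nlinarith
    simp only [hG]
    rw [div_le_one (hprod p hp)]
    refine le_trans ?_ (prod_lower P a ρ hρ hρ1 ha hsep p hp)
    have h1 : (1 - ‖p‖ ^ 2) ^ P.card ≤ (1 - ‖p‖ ^ 2) ^ 3 :=
      pow_le_pow_of_le_one hb.le (by nlinarith) hc
    have h2 : ρ ^ (2 * P.card) * ((1 - ‖p‖ ^ 2) / 2) ^ 2 = κ * (1 - ‖p‖ ^ 2) ^ 2 := by
      rw [hκ]; ring
    rw [h2]
    refine h1.trans ?_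
    have : (1 - ‖p‖ ^ 2) ^ 3 = (1 - ‖p‖ ^ 2) * (1 - ‖p‖ ^ 2) ^ 2 := by ring
    rw [this]
    gcongr
  have hKlt : ∀ p : ℂ, ‖p‖ ≤ √(1 - κ) → ‖p‖ < 1 := by
    intro p hp
    refine lt_of_le_of_lt hp ?_
    rw [Real.sqrt_lt' one_pos]; linarith
  have hcont : ContinuousOn G (Metric.closedBall 0 (√(1 - κ))) := by
    simp only [hG]
    apply ContinuousOn.div
    · fun_prop
    · fun_prop
    · intro p hp
      exact (hprod p (hKlt p (by simpa using hp))).ne'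
  obtain ⟨q, hq, hmax⟩ := (isCompact_closedBall (0 : ℂ) (√(1 - κ))).exists_isMaxOn
    ⟨0, by simp⟩ hcont
  have hq1 : 1 ≤ G q := by
    rw [← hG0]; exact hmax (by simp)
  refine ⟨q, hKlt q (by simpa using hq), ?_⟩
  intro p hp
  change G p ≤ G q
  by_cases h : ‖p‖ ≤ √(1 - κ)
  · exact hmax (by simpa using h)
  · push Not at h
    refine (hsmall p hp ?_).trans hq1
    rw [Real.sqrt_lt' (lt_of_le_of_lt (Real.sqrt_nonneg _) h)] at h
    linarith

lemma exists_barycenter (P : Finset ℂ) (a : ℂ → ℂ) (hinj : Set.InjOn a P)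
    (ha : ∀ x ∈ P, ‖a x‖ = 1) (hc : 3 ≤ P.card) :
    ∃ q : ℂ, ‖q‖ < 1 ∧
      ∑ x ∈ P, (((1 - ‖q‖ ^ 2 : ℝ) : ℂ) * (a x - q)⁻¹ - (starRingEnd ℂ) q) = 0 := by
  obtain ⟨q, hq, hmax⟩ := exists_max_poisson P a hinj ha hc
  refine ⟨q, hq, ?_⟩
  have hpos : ∀ p : ℂ, ‖p‖ < 1 → ∀ x ∈ P, 0 < ‖a x - p‖ ^ 2 := by
    intro p hp x hx
    have : 0 < ‖a x - p‖ := by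
      have := norm_sub_norm_le (a x) p
      rw [ha x hx] at this
      linarith
    positivity
  have hb : ∀ p : ℂ, ‖p‖ < 1 → 0 < 1 - ‖p‖ ^ 2 := by
    intro p hp; nlinarith [norm_nonneg p]
  -- logarithmic form
  have hlog : ∀ p : ℂ, ‖p‖ < 1 →
      P.card * Real.log (1 - ‖p‖ ^ 2) - ∑ x ∈ P, Real.log (‖a x - p‖ ^ 2) ≤
      P.card * Real.log (1 - ‖q‖ ^ 2) - ∑ x ∈ P, Real.log (‖a x - q‖ ^ 2) := by
    have key : ∀ p : ℂ, ‖p‖ < 1 →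
        Real.log ((1 - ‖p‖ ^ 2) ^ P.card / ∏ x ∈ P, ‖a x - p‖ ^ 2) =
        P.card * Real.log (1 - ‖p‖ ^ 2) - ∑ x ∈ P, Real.log (‖a x - p‖ ^ 2) := by
      intro p hp
      rw [Real.log_div (pow_pos (hb p hp) _).ne' (Finset.prod_pos (hpos p hp)).ne',
        Real.log_pow, Real.log_prod (fun x hx => (hpos p hp x hx).ne')]
    intro p hp
    rw [← key p hp, ← key q hq]
    exact Real.log_le_log (div_pos (pow_pos (hb p hp) _) (Finset.prod_pos (hpos p hp)))
      (hmax p hp)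
  set S := ∑ x ∈ P, (((1 - ‖q‖ ^ 2 : ℝ) : ℂ) * (a x - q)⁻¹ - (starRingEnd ℂ) q) with hS
  set h : ℂ := (starRingEnd ℂ) S with hh
  -- derivative of squared distance
  have hd : ∀ b c : ℂ, HasDerivAt (fun t : ℝ => ‖b + t * c‖ ^ 2)
      (2 * ((starRingEnd ℂ) b * c).re) 0 := by
    intro b c
    have e : (fun t : ℝ => ‖b + t * c‖ ^ 2) =
        fun t : ℝ => ‖b‖ ^ 2 + t * (2 * ((starRingEnd ℂ) b * c).re) + t ^ 2 * ‖c‖ ^ 2 := by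
      funext t
      simp only [← Complex.normSq_eq_norm_sq, Complex.normSq_apply]
      simp
      ring
    rw [e]
    have h1 := (((hasDerivAt_id (0:ℝ)).mul_const (2 * ((starRingEnd ℂ) b * c).re)).const_add
      (‖b‖ ^ 2)).add (((hasDerivAt_id (0:ℝ)).pow 2).mul_const (‖c‖ ^ 2))
    refine HasDerivAt.congr_deriv h1 ?_
    simp
  have hD : HasDerivAt (fun t : ℝ => P.card * Real.log (1 - ‖q + t * h‖ ^ 2) -
      ∑ x ∈ P, Real.log (‖a x - (q + t * h)‖ ^ 2))
      (P.card * (-(2 * ((starRingEnd ℂ) q * h).re) / (1 - ‖q‖ ^ 2)) -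
        ∑ x ∈ P, 2 * ((starRingEnd ℂ) (a x - q) * (-h)).re / ‖a x - q‖ ^ 2) 0 := by
    apply HasDerivAt.sub
    · apply HasDerivAt.const_mul
      have h1 := ((hd q h).const_sub 1).log (by simpa using (hb q hq).ne')
      simpa using h1
    · apply HasDerivAt.fun_sum
      intro x hx
      have h1 := (hd (a x - q) (-h)).log (by simpa using (hpos q hq x hx).ne')
      have e : (fun t : ℝ => Real.log (‖a x - (q + t * h)‖ ^ 2)) =
        fun t : ℝ => Real.log (‖a x - q + t * (-h)‖ ^ 2) := by
        funext t; congr 3; ring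
      rw [e]
      simpa using h1
  have hloc : IsLocalMax (fun t : ℝ => P.card * Real.log (1 - ‖q + t * h‖ ^ 2) -
      ∑ x ∈ P, Real.log (‖a x - (q + t * h)‖ ^ 2)) 0 := by
    have hev : ∀ᶠ t : ℝ in nhds 0, ‖q + t * h‖ < 1 := by
      have hcont : Continuous (fun t : ℝ => ‖q + t * h‖) := by fun_prop
      apply hcont.continuousAt.eventually_lt continuousAt_const
      simpa using hq
    filter_upwards [hev] with t ht
    simpa using hlog _ ht
  have hz := hloc.hasDerivAt_eq_zero hD
  -- identify with the sum
  have hqp := hb q hq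
  have hterm : ∀ x ∈ P, -(2 * ((starRingEnd ℂ) q * h).re) / (1 - ‖q‖ ^ 2) -
      2 * ((starRingEnd ℂ) (a x - q) * (-h)).re / ‖a x - q‖ ^ 2 =
      2 / (1 - ‖q‖ ^ 2) *
        ((((1 - ‖q‖ ^ 2 : ℝ) : ℂ) * (a x - q)⁻¹ - (starRingEnd ℂ) q) * h).re := by
    intro x hx
    have hn := hpos q hq x hx
    have hn0 : ‖a x - q‖ ≠ 0 := fun h => by rw [h] at hn; norm_num at hn
    have h1 : (starRingEnd ℂ) (a x - q) = ((‖a x - q‖ ^ 2 : ℝ) : ℂ) * (a x - q)⁻¹ := by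
      rw [Complex.inv_def, ← Complex.normSq_eq_norm_sq, mul_left_comm, ← Complex.ofReal_mul,
        mul_inv_cancel₀]
      · simp
      · rw [Complex.normSq_eq_norm_sq]; exact hn.ne'
    rw [h1, sub_mul, Complex.sub_re, mul_assoc, mul_assoc, Complex.re_ofReal_mul,
      Complex.re_ofReal_mul, mul_neg, Complex.neg_re]
    generalize ‖a x - q‖ = N at *
    field_simp
    ring
  have hz2 : 2 / (1 - ‖q‖ ^ 2) * (S * h).re = 0 := by
    rw [hS, Finset.sum_mul, Complex.re_sum, Finset.mul_sum, ← Finset.sum_congr rfl hterm,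
      Finset.sum_sub_distrib, Finset.sum_const, nsmul_eq_mul]
    exact hz
  have hz3 : (S * h).re = 0 := by
    rcases mul_eq_zero.mp hz2 with h | h
    · have : 0 < 2 / (1 - ‖q‖ ^ 2) := by positivity
      linarith
    · exact h
  rw [hh, Complex.mul_conj, Complex.ofReal_re] at hz3
  exact Complex.normSq_eq_zero.mp hz3

lemma unit_norm (q a : ℂ) (hq : ‖q‖ < 1) (ha : ‖a‖ = 1) :
    ‖((1 - ‖q‖ ^ 2 : ℝ) : ℂ) * (a - q)⁻¹ - (starRingEnd ℂ) q‖ = 1 := by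
  have h0 : a - q ≠ 0 := by
    intro h
    rw [sub_eq_zero] at h
    rw [← h] at hq; linarith
  have haa : a * (starRingEnd ℂ) a = 1 := by
    rw [Complex.mul_conj, Complex.normSq_eq_norm_sq, ha]; simp
  have hqq : ((1 - ‖q‖ ^ 2 : ℝ) : ℂ) = 1 - q * (starRingEnd ℂ) q := by
    rw [Complex.mul_conj, Complex.normSq_eq_norm_sq]; push_cast; ring
  have key : ((1 - ‖q‖ ^ 2 : ℝ) : ℂ) * (a - q)⁻¹ - (starRingEnd ℂ) q =
      a * (starRingEnd ℂ) (a - q) * (a - q)⁻¹ := by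
    rw [hqq, map_sub]
    field_simp
    linear_combination -haa
  rw [key, norm_mul, norm_mul, norm_inv, RCLike.norm_conj, ha, one_mul,
    mul_inv_cancel₀ (norm_ne_zero_iff.mpr h0)]

lemma inside_of_outside (q ζ : ℂ) (hq : ‖q‖ < 1) (hζ : ζ ≠ 0)
    (h : 1 ≤ ‖((1 - ‖q‖ ^ 2 : ℝ) : ℂ) * ζ⁻¹ - (starRingEnd ℂ) q‖) : ‖ζ + q‖ ≤ 1 := by
  have hk : 0 < 1 - ‖q‖ ^ 2 := by nlinarith [norm_nonneg q]
  have h1 : ‖ζ‖ ≤ ‖((1 - ‖q‖ ^ 2 : ℝ) : ℂ) - (starRingEnd ℂ) q * ζ‖ := by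
    have e : ((1 - ‖q‖ ^ 2 : ℝ) : ℂ) - (starRingEnd ℂ) q * ζ =
        (((1 - ‖q‖ ^ 2 : ℝ) : ℂ) * ζ⁻¹ - (starRingEnd ℂ) q) * ζ := by
      field_simp
    rw [e, norm_mul]
    exact le_mul_of_one_le_left (norm_nonneg _) h
  have h2 : ‖ζ‖ ^ 2 ≤ ‖((1 - ‖q‖ ^ 2 : ℝ) : ℂ) - (starRingEnd ℂ) q * ζ‖ ^ 2 := by gcongr
  set k := 1 - ‖q‖ ^ 2 with hkdef
  have hq2 : q.re * q.re + q.im * q.im = 1 - k := by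
    rw [hkdef, ← Complex.normSq_eq_norm_sq, Complex.normSq_apply]; ring
  have h3 : ‖ζ + q‖ ^ 2 ≤ 1 := by
    rw [← Complex.normSq_eq_norm_sq, Complex.normSq_apply] at h2 ⊢
    rw [← Complex.normSq_eq_norm_sq, Complex.normSq_apply] at h2
    simp at h2 ⊢
    have : 0 ≤ k * (1 - ((ζ.re + q.re) * (ζ.re + q.re) + (ζ.im + q.im) * (ζ.im + q.im))) := by
      have e : k = 1 - (q.re * q.re + q.im * q.im) := by linarith
      generalize k = k' at *
      subst e
      nlinarith
    have := nonneg_of_mul_nonneg_right this hk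
    linarith
  nlinarith [norm_nonneg (ζ + q)]

open Real in
/-- Given a circle `C` (center `o`, radius `R`) and a finite set `P` of `n`
points on `C`, there exist a point `p` inside `C` and `n` circular arcs (or segments)
connecting `p` to the points of `P`, all lying inside the closed disk bounded by `C`,
pairwise disjoint except at `p`, and whose tangent directions at `p` are equally spaced
at angles of `2π/n`. -/
theorem exists_fan_to_boundary_points
    (o : ℂ) (R : ℝ) (hR : 0 < R) (P : Finset ℂ)
    (hP : ∀ x ∈ P, dist x o = R) (hne : P.Nonempty) :
    ∃ p : ℂ, dist p o < R ∧
      ∃ f : (x : ℂ) → x ∈ P → Piece,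
        (∀ (x : ℂ) (hx : x ∈ P), (f x hx).Nondeg ∧ (f x hx).source = p ∧
          (f x hx).target = x ∧ (f x hx).image ⊆ Metric.closedBall o R) ∧
        (∀ (x : ℂ) (hx : x ∈ P) (y : ℂ) (hy : y ∈ P), x ≠ y →
          (f x hx).image ∩ (f y hy).image ⊆ {p}) ∧
        ∃ (θ : ℝ) (e : {x // x ∈ P} ≃ Fin P.card),
          ∀ (x : ℂ) (hx : x ∈ P),
            dirAngle ((f x hx).tangent 0) =
              ((θ + 2 * π * ((e ⟨x, hx⟩ : Fin P.card) : ℕ) / P.card : ℝ) : Real.Angle) := by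
  have hRC : (R : ℂ) ≠ 0 := by exact_mod_cast hR.ne'
  have hpi := Real.pi_pos
  set a : ℂ → ℂ := fun x => (x - o) / R with ha_def
  have ha : ∀ x ∈ P, ‖a x‖ = 1 := by
    intro x hx
    have := hP x hx
    rw [Complex.dist_eq] at this
    simp only [ha_def]
    rw [norm_div, this, Complex.norm_real, Real.norm_of_nonneg hR.le, div_self hR.ne']
  have hainj : Set.InjOn a P := by
    intro x _ y _ hxy
    simp only [ha_def] at hxy
    field_simp at hxy
    simpa using hxy
  obtain ⟨q, hq, hsum⟩ : ∃ q : ℂ, ‖q‖ < 1 ∧ (P.card ≤ 2 ∨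
      ∑ x ∈ P, (((1 - ‖q‖ ^ 2 : ℝ) : ℂ) * (a x - q)⁻¹ - (starRingEnd ℂ) q) = 0) := by
    by_cases h : P.card ≤ 2
    · exact ⟨0, by simp, Or.inl h⟩
    · obtain ⟨q, h1, h2⟩ := exists_barycenter P a hainj ha (by omega)
      exact ⟨q, h1, Or.inr h2⟩
  have hk : 0 < 1 - ‖q‖ ^ 2 := by nlinarith [norm_nonneg q]
  set k : ℝ := 1 - ‖q‖ ^ 2 with hkdef
  have hkC : (k : ℂ) ≠ 0 := by exact_mod_cast hk.ne'
  set u : ℂ → ℂ := fun x => (k : ℂ) * (a x - q)⁻¹ - (starRingEnd ℂ) q with hu_def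
  have hu : ∀ x ∈ P, ‖u x‖ = 1 := fun x hx => unit_norm q (a x) hq (ha x hx)
  have huinj : Set.InjOn u P := by
    intro x hx y hy hxy
    apply hainj hx hy
    simp only [hu_def] at hxy
    have h1 := mul_left_cancel₀ hkC (sub_left_injective hxy)
    exact sub_left_injective (inv_injective h1)
  obtain ⟨θ, e, φ, hφ, hφr, huφ, hdev⟩ := exists_matching P hne u huinj hu hsum
  have hn : (0 : ℝ) < P.card := by exact_mod_cast Finset.card_pos.mpr hne
  set A : Fin P.card → ℝ := fun k => θ + 2 * Real.pi * (k : ℕ) / P.card with hA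
  set p : ℂ := o + R * q with hp
  have hpo : dist p o < R := by
    rw [Complex.dist_eq, hp, add_sub_cancel_left, norm_mul, Complex.norm_real,
      Real.norm_of_nonneg hR.le]
    nlinarith
  have hq' : ‖-(starRingEnd ℂ) q‖ < 1 := by rw [norm_neg, RCLike.norm_conj]; exact hq
  -- existence of a single arc
  have hex : ∀ x : {x // x ∈ P}, ∃ Q : Piece, Q.Nondeg ∧ Q.source = p ∧ Q.target = x ∧
      dirAngle (Q.tangent 0) = ((-A (e x) : ℝ) : Real.Angle) ∧
      ∀ z ∈ Q.image, z = p ∨ ∃ s : ℝ, 0 ≤ s ∧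
        (k : ℂ) * ((z - p) / R)⁻¹ - (starRingEnd ℂ) q =
        Complex.exp (φ (e x) * Complex.I) + s * Complex.exp (A (e x) * Complex.I) := by
    intro x
    have hxw : (x : ℂ) - p = R * (a x - q) := by
      simp only [ha_def, hp]; field_simp; ring
    have haq : a x - q ≠ 0 := by
      intro h
      rw [sub_eq_zero] at h
      have := ha x x.2
      rw [h] at this; linarith
    have hw0 : (x : ℂ) - p ≠ 0 := by rw [hxw]; exact mul_ne_zero hRC haq
    have hux : u x = k * R * ((x : ℂ) - p)⁻¹ - (starRingEnd ℂ) q := by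
      simp only [hu_def]; rw [hxw]; field_simp
    have hEE : Complex.exp (A (e x) * Complex.I) ≠ 0 := Complex.exp_ne_zero _
    have hneg : -(((-A (e x) : ℝ) : ℂ) * Complex.I) = A (e x) * Complex.I := by push_cast; ring
    have hslit : ((x : ℂ) - p) * Complex.exp (-(((-A (e x) : ℝ) : ℂ) * Complex.I)) ∈
        Complex.slitPlane := by
      rw [hneg]
      by_contra hcon
      rw [Complex.mem_slitPlane_iff_not_le_zero, not_not] at hcon
      set y := ((x : ℂ) - p) * Complex.exp (A (e x) * Complex.I) with hy
      have hy0 : y ≠ 0 := mul_ne_zero hw0 hEE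
      rw [Complex.le_def] at hcon
      have hyr : y = (y.re : ℂ) := Complex.ext rfl (by simpa using hcon.2)
      have hyre : y.re ≤ 0 := by simpa using hcon.1
      have hyC : (y.re : ℂ) ≠ 0 := by rw [← hyr]; exact hy0
      obtain ⟨hge, -⟩ := ray_polar (φ (e x)) (A (e x)) (k * R * (-y.re)⁻¹)
        (by have : 0 ≤ -y.re := by linarith
            positivity) (hdev _)
      have hz : Complex.exp (φ (e x) * Complex.I) +
          ((k * R * (-y.re)⁻¹ : ℝ) : ℂ) * Complex.exp (A (e x) * Complex.I) =
          -(starRingEnd ℂ) q := by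
        rw [← huφ x, hux]
        have : ((x : ℂ) - p)⁻¹ = Complex.exp (A (e x) * Complex.I) * (y.re : ℂ)⁻¹ := by
          rw [← hyr, hy]; field_simp
        rw [this]
        push_cast
        rw [inv_neg]
        ring
      rw [hz] at hge
      linarith
    obtain ⟨Q, h1, h2, h3, h4, h5⟩ := piece_exists p ((x : ℂ) - p) (-A (e x)) hslit
    refine ⟨Q, h1, h2, by rw [h3]; ring, h4, ?_⟩
    intro z hz
    refine (h5 z hz).imp id ?_
    rintro ⟨s, hs, hzs⟩
    refine ⟨k * R * s, by positivity, ?_⟩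
    rw [hneg] at hzs
    rw [← huφ x, hux, inv_div, div_eq_mul_inv, hzs]
    push_cast
    ring
  choose f hf1 hf2 hf3 hf4 hf5 using hex
  refine ⟨p, hpo, fun x hx => f ⟨x, hx⟩, ?_, ?_, ?_⟩
  · intro x hx
    refine ⟨hf1 _, hf2 _, hf3 _, ?_⟩
    intro z hz
    rw [Metric.mem_closedBall]
    by_cases hzp : z = p
    · rw [hzp]; exact hpo.le
    rcases hf5 _ z hz with h | ⟨s, hs, h⟩
    · exact absurd h hzp
    obtain ⟨hge, -⟩ := ray_polar (φ (e ⟨x, hx⟩)) (A (e ⟨x, hx⟩)) s hs (hdev _)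
    rw [← h] at hge
    have h2 := inside_of_outside q ((z - p) / R) hq
      (div_ne_zero (sub_ne_zero.mpr hzp) hRC) hge
    have h3 : z - o = R * ((z - p) / R + q) := by
      rw [hp]; field_simp; ring
    rw [Complex.dist_eq, h3, norm_mul, Complex.norm_real, Real.norm_of_nonneg hR.le]
    nlinarith
  · -- disjointness
    have hlt : ∀ x y : {x // x ∈ P}, e x < e y → ∀ z, z ∈ (f x).image → z ∈ (f y).image →
        z = p := by
      intro x y hxy z hzx hzy
      by_contra hzp
      rcases hf5 _ z hzx with h | ⟨s, hs, h⟩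
      · exact hzp h
      rcases hf5 _ z hzy with h' | ⟨s', hs', h'⟩
      · exact hzp h'
      have hv : ((e x : ℕ) : ℝ) < ((e y : ℕ) : ℝ) := by exact_mod_cast hxy
      have hvn : ((e y : ℕ) : ℝ) < P.card := by exact_mod_cast (e y).2
      have hv0 : (0 : ℝ) ≤ ((e x : ℕ) : ℝ) := by positivity
      refine rays_disjoint (φ (e x)) (φ (e y)) (A (e x)) (A (e y)) s s' hs hs' (hdev _) (hdev _)
        (hφ hxy) (hφr _ _) ?_ ?_ (h.symm.trans h')
      · simp only [hA]; gcongr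
      · simp only [hA]
        have h1 : 2 * Real.pi * ((e y : ℕ) : ℝ) / P.card < 2 * Real.pi := by
          rw [div_lt_iff₀ hn]; gcongr
        have h2 : 0 ≤ 2 * Real.pi * ((e x : ℕ) : ℝ) / P.card := by positivity
        linarith
    rintro x hx y hy hxy z ⟨hzx, hzy⟩
    have hne' : e ⟨x, hx⟩ ≠ e ⟨y, hy⟩ := by
      intro h
      exact hxy (congrArg Subtype.val (e.injective h))
    rcases lt_or_gt_of_ne hne' with h | h
    · exact hlt _ _ h z hzx hzy
    · exact hlt _ _ h z hzy hzx
  · refine ⟨-θ - 2 * Real.pi * (P.card - 1) / P.card, e.trans Fin.revPerm, ?_⟩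
    intro x hx
    rw [hf4]
    congr 1
    simp only [hA, Equiv.trans_apply, Fin.revPerm_apply, Fin.val_rev]
    have := (e ⟨x, hx⟩).2
    rw [Nat.cast_sub (by omega)]
    push_cast
    ring
end
end
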